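/- arXiv:1404.6739 — 5 statements merged into one kernel-verified Lean document; each statement's English description precedes it below -/
import Mathlib

section
/- There exist a constant c > 0 and a natural number n₀ such that the following holds. Let X be a finite set with n := |X| ≥ n₀, and let M ≤ Sym(X) be a subgroup that is both primitive and a maximal subgroup. Then the number of subsets Y ⊆ X for which there exists a non-identity element g ∈ M with g(Y) = Y is at most 2^n · exp(−c·√n). -/
/-- A subgroup `G ≤ Sym(X)` is primitive if its natural action on `X` is transitive
and every `G`-block is trivial (i.e. the action is preprimitive). -/
def IsPrimitiveSubgroup {X : Type*} (G : Subgroup (Equiv.Perm X)) : Prop :=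
  MulAction.IsPretransitive G X ∧ ∀ B : Set X, MulAction.IsBlock G B → MulAction.IsTrivialBlock B

/-- `M ≤ Sym(X)` is a maximal subgroup if it is neither `Sym(X)` nor `Alt(X)` and it is
maximal under inclusion among subgroups of `Sym(X)` different from `Sym(X)` and `Alt(X)`. -/
def IsMaximalSubgroup {X : Type*} [Fintype X] [DecidableEq X]
    (M : Subgroup (Equiv.Perm X)) : Prop :=
  M ≠ ⊤ ∧ M ≠ alternatingGroup X ∧
    ∀ K : Subgroup (Equiv.Perm X), K ≠ ⊤ → K ≠ alternatingGroup X → M ≤ K → K = M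

open Finset in
open scoped Classical in
/-- The set of points moved by a permutation. -/
noncomputable def movedPoints {X : Type*} [Fintype X] (g : Equiv.Perm X) : Finset X :=
  univ.filter fun x => g x ≠ x

theorem mem_movedPoints {X : Type*} [Fintype X] {g : Equiv.Perm X} {x : X} :
    x ∈ movedPoints g ↔ g x ≠ x := by
  simp [movedPoints]

/-- Twice the number of cycles (including fixed points) is at most `2 n` minus the number of
moved points. -/
theorem two_mul_card_cycles_add_card_movedPoints_le {X : Type*} [Fintype X] (g : Equiv.Perm X) :
    2 * Nat.card (Quotient (Equiv.Perm.SameCycle.setoid g)) + (movedPoints g).card ≤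
      2 * Fintype.card X := by
  classical
  set Q := Quotient (Equiv.Perm.SameCycle.setoid g)
  let mk : X → Q := Quotient.mk _
  have hfib : ∀ q : Q, 2 ≤ (Finset.univ.filter fun x => mk x = q).card +
      ((movedPoints g)ᶜ.filter fun x => mk x = q).card := by
    intro q
    obtain ⟨x, rfl⟩ := Quotient.exists_rep q
    by_cases hx : g x = x
    · have h1 : 0 < (Finset.univ.filter fun z => mk z = mk x).card :=
        Finset.card_pos.mpr ⟨x, by simp⟩
      have h2 : 0 < ((movedPoints g)ᶜ.filter fun z => mk z = mk x).card :=
        Finset.card_pos.mpr ⟨x, by simp [mem_movedPoints, hx]⟩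
      change 2 ≤ (Finset.univ.filter fun z => mk z = mk x).card +
        ((movedPoints g)ᶜ.filter fun z => mk z = mk x).card
      omega
    · have h1 : 1 < (Finset.univ.filter fun z => mk z = mk x).card := by
        refine Finset.one_lt_card.mpr ⟨x, by simp, g x, ?_, fun h => hx h.symm⟩
        simp only [Finset.mem_filter, Finset.mem_univ, true_and]
        exact Quotient.sound (s := Equiv.Perm.SameCycle.setoid g)
          (Equiv.Perm.sameCycle_apply_left.mpr (Equiv.Perm.SameCycle.refl g x))
      exact le_add_right h1
  have hsum := Finset.sum_le_sum fun q (_ : q ∈ (Finset.univ : Finset Q)) => hfib q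
  rw [Finset.sum_add_distrib,
    ← Finset.card_eq_sum_card_fiberwise (fun x _ => Finset.mem_coe.mpr (Finset.mem_univ (mk x))),
    ← Finset.card_eq_sum_card_fiberwise (fun x _ => Finset.mem_coe.mpr (Finset.mem_univ (mk x))),
    Finset.sum_const, Finset.card_compl, smul_eq_mul, Finset.card_univ, Finset.card_univ] at hsum
  have := Finset.card_le_univ (movedPoints g)
  rw [Nat.card_eq_fintype_card]
  omega

open scoped Pointwise in
theorem ncard_fixed_sets_le {X : Type*} [Fintype X] (g : Equiv.Perm X) :
    (Set.ncard {Y : Set X | (g : X → X) '' Y = Y} : ℝ) ≤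
      2 ^ Fintype.card X * (2 : ℝ) ^ (-((movedPoints g).card : ℝ) / 2) := by
  classical
  set Q := Quotient (Equiv.Perm.SameCycle.setoid g)
  let mk : X → Q := Quotient.mk _
  have hsub : {Y : Set X | (g : X → X) '' Y = Y} ⊆ Set.range fun S : Set Q => mk ⁻¹' S := by
    intro Y hY
    refine ⟨mk '' Y, ?_⟩
    ext x
    constructor
    · rintro ⟨y, hy, hyx⟩
      obtain ⟨i, hi⟩ : g.SameCycle y x := Quotient.exact hyx
      have hst : g ∈ MulAction.stabilizer (Equiv.Perm X) Y := hY
      have := (MulAction.stabilizer (Equiv.Perm X) Y).zpow_mem hst i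
      rw [MulAction.mem_stabilizer_iff] at this
      rw [← this]
      exact ⟨y, hy, hi⟩
    · exact fun hx => ⟨x, hx, rfl⟩
  have h1 : Set.ncard {Y : Set X | (g : X → X) '' Y = Y} ≤ 2 ^ Nat.card Q := by
    refine (Set.ncard_le_ncard hsub (Set.toFinite _)).trans ?_
    rw [← Set.image_univ]
    refine (Set.ncard_image_le (Set.toFinite _)).trans ?_
    rw [Set.ncard_univ, Nat.card_eq_fintype_card, Nat.card_eq_fintype_card, Fintype.card_set]
  have h2 := two_mul_card_cycles_add_card_movedPoints_le g
  calc (Set.ncard {Y : Set X | (g : X → X) '' Y = Y} : ℝ) ≤ 2 ^ Nat.card Q := by exact_mod_cast h1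
    _ = (2 : ℝ) ^ (Nat.card Q : ℝ) := (Real.rpow_natCast _ _).symm
    _ ≤ (2 : ℝ) ^ ((Fintype.card X : ℝ) + (-((movedPoints g).card : ℝ) / 2)) := by
        apply Real.rpow_le_rpow_of_exponent_le one_le_two
        have : (2 * (Nat.card Q : ℝ) + (movedPoints g).card) ≤ 2 * Fintype.card X := by
          exact_mod_cast h2
        linarith
    _ = _ := by rw [Real.rpow_add two_pos, Real.rpow_natCast]

open scoped Classical in
/-- The number of coordinates of the tuple `B` moved by `g`. -/
noncomputable def movedCount {X κ : Type*} [Fintype κ] (g : Equiv.Perm X) (B : κ → X) : ℕ :=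
  (Finset.univ.filter fun i => g (B i) ≠ B i).card

/-- The tuple `B` is a base for `M`: its pointwise stabilizer in `M` is trivial. -/
def IsBaseTuple {X κ : Type*} (M : Subgroup (Equiv.Perm X)) (B : κ → X) : Prop :=
  ∀ g ∈ M, (∀ i, g (B i) = B i) → g = 1

open scoped Classical in
theorem sum_pow_movedCount_le {X κ : Type*} [Fintype X] [Fintype κ]
    {M : Subgroup (Equiv.Perm X)} {B : κ → X} (hB : IsBaseTuple M B) {q : ℝ} (hq : 0 ≤ q) :
    ∑ g : M, q ^ movedCount (g : Equiv.Perm X) B ≤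
      (1 + Fintype.card X * q) ^ Fintype.card κ := by
  let w : κ → X → ℝ := fun i x => if x ≠ B i then q else 1
  have hw : ∀ i x, 0 ≤ w i x := fun i x => by dsimp only [w]; split_ifs <;> positivity
  have hinj : Function.Injective fun (g : M) (i : κ) => (g : Equiv.Perm X) (B i) := by
    intro g h hgh
    have : (h⁻¹ * g : Equiv.Perm X) = 1 := by
      refine hB _ (M.mul_mem (M.inv_mem h.2) g.2) fun i => ?_
      have := congrFun hgh i
      simp only at this
      simp [Equiv.Perm.mul_apply, this]
    exact Subtype.ext (inv_mul_eq_one.mp this).symm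
  calc ∑ g : M, q ^ movedCount (g : Equiv.Perm X) B
      = ∑ g : M, ∏ i, w i ((g : Equiv.Perm X) (B i)) := by
        refine Finset.sum_congr rfl fun g _ => ?_
        simp only [w, movedCount]
        rw [Finset.prod_ite, Finset.prod_const, Finset.prod_const_one, mul_one]
    _ = ∑ φ ∈ Finset.univ.image fun (g : M) (i : κ) => (g : Equiv.Perm X) (B i),
          ∏ i, w i (φ i) := by
        rw [Finset.sum_image fun _ _ _ _ h => hinj h]
    _ ≤ ∑ φ : κ → X, ∏ i, w i (φ i) :=
        Finset.sum_le_sum_of_subset_of_nonneg (Finset.subset_univ _)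
          fun φ _ _ => Finset.prod_nonneg fun i _ => hw i _
    _ = ∏ i, ∑ x, w i x := by
        rw [Finset.prod_univ_sum, Fintype.piFinset_univ]
    _ ≤ ∏ _i : κ, (1 + Fintype.card X * q) := by
        refine Finset.prod_le_prod (fun i _ => Finset.sum_nonneg fun x _ => hw i x) fun i _ => ?_
        calc ∑ x, w i x ≤ ∑ x, ((if x = B i then 1 else 0) + q) := by
              refine Finset.sum_le_sum fun x _ => ?_
              dsimp only [w]
              split_ifs <;> simp_all
          _ = 1 + Fintype.card X * q := by
              simp [Finset.sum_add_distrib]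
    _ = _ := by rw [Finset.prod_const, Finset.card_univ]

open scoped Classical in
theorem card_tuples_apply_mem {X κ : Type*} [Fintype X] [Fintype κ] (i : κ) (S : Finset X) :
    (Finset.univ.filter fun B : κ → X => B i ∈ S).card * Fintype.card X =
      S.card * Fintype.card X ^ Fintype.card κ := by
  have h : (Finset.univ.filter fun B : κ → X => B i ∈ S) =
      Fintype.piFinset fun j => if j = i then S else Finset.univ := by
    ext B
    simp only [Finset.mem_filter, Finset.mem_univ, true_and, Fintype.mem_piFinset]
    refine ⟨fun h j => ?_, fun h => by simpa using h i⟩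
    split_ifs with hj
    · exact hj ▸ h
    · simp
  rw [h, Fintype.card_piFinset, ← Finset.mul_prod_erase _ _ (Finset.mem_univ i), if_pos rfl,
    Finset.prod_congr rfl (g := fun _ => Fintype.card X), Finset.prod_const,
    Finset.card_erase_of_mem (Finset.mem_univ i), Finset.card_univ, mul_assoc, ← pow_succ,
    Nat.sub_add_cancel (Fintype.card_pos_iff.mpr ⟨i⟩)]
  intro j hj
  rw [if_neg (Finset.ne_of_mem_erase hj), Finset.card_univ]

open scoped Classical in
theorem sum_movedCount {X κ : Type*} [Fintype X] [Fintype κ] (g : Equiv.Perm X) :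
    (∑ B : κ → X, movedCount g B) * Fintype.card X =
      Fintype.card κ * (movedPoints g).card * Fintype.card X ^ Fintype.card κ := by
  have h : ∑ B : κ → X, movedCount g B =
      ∑ i : κ, (Finset.univ.filter fun B : κ → X => B i ∈ movedPoints g).card := by
    simp only [movedCount, Finset.card_filter, mem_movedPoints]
    rw [Finset.sum_comm]
  rw [h, Finset.sum_mul, Finset.sum_congr rfl fun i _ => card_tuples_apply_mem i _,
    Finset.sum_const, Finset.card_univ, smul_eq_mul, mul_assoc]

open scoped Classical in
/-- Markov's inequality for the number of moved coordinates of a random tuple. -/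
theorem card_movedCount_gt_le {X κ : Type*} [Fintype X] [Fintype κ] [Nonempty X]
    (g : Equiv.Perm X) :
    ((Finset.univ.filter fun B : κ → X =>
        3 * ((movedPoints g).card : ℝ) * Fintype.card κ / Fintype.card X < movedCount g B).card : ℝ)
      ≤ (Fintype.card X : ℝ) ^ Fintype.card κ / 3 := by
  have hn : (0 : ℝ) < Fintype.card X := by exact_mod_cast Fintype.card_pos
  set r : ℝ := 3 * ((movedPoints g).card : ℝ) * Fintype.card κ / Fintype.card X with hr
  set F := Finset.univ.filter fun B : κ → X => r < movedCount g B
  have hsum : (∑ B : κ → X, (movedCount g B : ℝ)) * Fintype.card X =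
      Fintype.card κ * (movedPoints g).card * (Fintype.card X : ℝ) ^ Fintype.card κ := by
    exact_mod_cast sum_movedCount g
  have hsum' : 3 * ∑ B : κ → X, (movedCount g B : ℝ) =
      r * (Fintype.card X : ℝ) ^ Fintype.card κ := by
    rw [hr, div_mul_eq_mul_div, eq_div_iff hn.ne', mul_assoc 3, hsum]
    ring
  have hF : ∑ B ∈ F, (movedCount g B : ℝ) ≤ ∑ B : κ → X, (movedCount g B : ℝ) :=
    Finset.sum_le_sum_of_subset_of_nonneg (Finset.subset_univ _) fun _ _ _ => Nat.cast_nonneg _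
  have hr0 : 0 ≤ r := by positivity
  rcases hr0.eq_or_lt with h0 | h0
  · have hF0 : F = ∅ := by
      rw [← h0, zero_mul] at hsum'
      have hz : ∀ B : κ → X, (movedCount g B : ℝ) = 0 := fun B =>
        (Finset.sum_eq_zero_iff_of_nonneg fun _ _ => Nat.cast_nonneg _).mp
          (by linarith) B (Finset.mem_univ B)
      refine Finset.filter_eq_empty_iff.mpr fun B _ => ?_
      rw [hz B, ← h0]
      exact lt_irrefl _
    rw [hF0]
    simp only [Finset.card_empty, Nat.cast_zero]
    positivity
  · have h1 : (F.card : ℝ) * r ≤ ∑ B ∈ F, (movedCount g B : ℝ) := by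
      rw [← nsmul_eq_mul]
      exact Finset.card_nsmul_le_sum _ _ _ fun B hB => (Finset.mem_filter.mp hB).2.le
    refine le_of_mul_le_mul_right ?_ h0
    linarith

open scoped Classical in
/-- If most tuples are bases of `M`, then the elements of `M` with few moved points are rare. -/
theorem sum_pow_movedPoints_le {X κ : Type*} [Fintype X] [Fintype κ] [Nonempty X]
    (M : Subgroup (Equiv.Perm X)) {q : ℝ} (hq : 0 < q) (hq1 : q ≤ 1)
    (hbase : ((Finset.univ.filter fun B : κ → X => ¬ IsBaseTuple M B).card : ℝ) ≤
      (Fintype.card X : ℝ) ^ Fintype.card κ / 3) :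
    ∑ g : M, q ^ (3 * ((movedPoints (g : Equiv.Perm X)).card : ℝ) * Fintype.card κ /
      Fintype.card X) ≤ 3 * (1 + Fintype.card X * q) ^ Fintype.card κ := by
  have hn : (0 : ℝ) < Fintype.card X := by exact_mod_cast Fintype.card_pos
  set N : ℝ := (Fintype.card X : ℝ) ^ Fintype.card κ with hN
  have hN0 : 0 < N := by positivity
  have hcard : ((Finset.univ : Finset (κ → X)).card : ℝ) = N := by
    rw [Finset.card_univ, Fintype.card_fun]; push_cast; rfl
  set r : Equiv.Perm X → ℝ := fun g =>
    3 * ((movedPoints g).card : ℝ) * Fintype.card κ / Fintype.card X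
  set S := Finset.univ.filter fun B : κ → X => IsBaseTuple M B
  have hgood : ∀ g : M, N / 3 * q ^ r g ≤ ∑ B ∈ S, q ^ movedCount (g : Equiv.Perm X) B := by
    intro g
    set G := S.filter fun B => (movedCount (g : Equiv.Perm X) B : ℝ) ≤ r g
    have hG : N / 3 ≤ G.card := by
      have hsub : (Finset.univ : Finset (κ → X)) ⊆ G ∪
          ((Finset.univ.filter fun B : κ → X => ¬ IsBaseTuple M B) ∪
          (Finset.univ.filter fun B : κ → X => r g < movedCount (g : Equiv.Perm X) B)) := by
        intro B _
        by_cases h1 : IsBaseTuple M B <;>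
          by_cases h2 : (movedCount (g : Equiv.Perm X) B : ℝ) ≤ r g <;>
          simp_all [G, S]
      have h1 := (Finset.card_le_card hsub).trans ((Finset.card_union_le _ _).trans
        (add_le_add_right (Finset.card_union_le _ _) _))
      have h2 : N ≤ G.card + (N / 3 + N / 3) := by
        rw [← hcard]
        have h3 := card_movedCount_gt_le (κ := κ) (g : Equiv.Perm X)
        rw [hcard]
        calc N ≤ (G.card : ℝ) + (((Finset.univ.filter fun B : κ → X =>
              ¬ IsBaseTuple M B).card : ℝ) + ((Finset.univ.filter fun B : κ → X =>
              r g < movedCount (g : Equiv.Perm X) B).card : ℝ)) := by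
              rw [← hcard]; exact_mod_cast h1
          _ ≤ _ := by gcongr
      linarith
    calc N / 3 * q ^ r g ≤ G.card * q ^ r g := by gcongr
      _ = ∑ B ∈ G, q ^ r g := by rw [Finset.sum_const, nsmul_eq_mul]
      _ ≤ ∑ B ∈ G, q ^ movedCount (g : Equiv.Perm X) B := by
          refine Finset.sum_le_sum fun B hB => ?_
          rw [← Real.rpow_natCast]
          exact Real.rpow_le_rpow_of_exponent_ge hq hq1 (Finset.mem_filter.mp hB).2
      _ ≤ _ := Finset.sum_le_sum_of_subset_of_nonneg (Finset.filter_subset _ _)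
          fun _ _ _ => by positivity
  have hmain : N / 3 * ∑ g : M, q ^ r g ≤ N * (1 + Fintype.card X * q) ^ Fintype.card κ := by
    calc N / 3 * ∑ g : M, q ^ r g
        ≤ ∑ g : M, ∑ B ∈ S, q ^ movedCount (g : Equiv.Perm X) B := by
          rw [Finset.mul_sum]; exact Finset.sum_le_sum fun g _ => hgood g
      _ = ∑ B ∈ S, ∑ g : M, q ^ movedCount (g : Equiv.Perm X) B := Finset.sum_comm
      _ ≤ ∑ B ∈ S, (1 + Fintype.card X * q) ^ Fintype.card κ :=
          Finset.sum_le_sum fun B hB => sum_pow_movedCount_le (Finset.mem_filter.mp hB).2 hq.le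
      _ = S.card * (1 + Fintype.card X * q) ^ Fintype.card κ := by
          rw [Finset.sum_const, nsmul_eq_mul]
      _ ≤ N * (1 + Fintype.card X * q) ^ Fintype.card κ := by
          rw [← hcard]
          gcongr
          exact Finset.subset_univ _
  refine le_of_mul_le_mul_left ?_ (show 0 < N / 3 by positivity)
  linarith

/-- `x` and `y` lie in the same orbit of the pointwise stabilizer of the tuple `t` in `M`. -/
def SameOrbitFixing {X ι : Type*} (M : Subgroup (Equiv.Perm X)) (t : ι → X) (x y : X) : Prop :=
  ∃ g ∈ M, (∀ i, g (t i) = t i) ∧ g x = y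

open scoped Classical in
/-- If a random `ι`-tuple separates any two given points with probability at least `δ`, then
the concatenation of `l` random `ι`-tuples is usually a base. -/
theorem card_not_isBaseTuple_le {X ι : Type*} [Fintype X] [Fintype ι]
    (M : Subgroup (Equiv.Perm X)) {δ : ℝ} (hδ : δ ≤ 1) (l : ℕ)
    (hsep : ∀ x y : X, x ≠ y → δ * (Fintype.card X : ℝ) ^ Fintype.card ι ≤
      (Finset.univ.filter fun t : ι → X => ¬ SameOrbitFixing M t x y).card) :
    ((Finset.univ.filter fun B : Fin l × ι → X => ¬ IsBaseTuple M B).card : ℝ) ≤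
      (Fintype.card X : ℝ) ^ 2 * (1 - δ) ^ l *
        (Fintype.card X : ℝ) ^ Fintype.card (Fin l × ι) := by
  set E : X × X → Finset (Fin l × ι → X) := fun p => Finset.univ.filter fun B =>
    ∀ j, SameOrbitFixing M (fun i => B (j, i)) p.1 p.2
  have hsub : (Finset.univ.filter fun B : Fin l × ι → X => ¬ IsBaseTuple M B) ⊆
      (Finset.univ.filter fun p : X × X => p.1 ≠ p.2).biUnion E := by
    intro B hB
    simp only [Finset.mem_filter, Finset.mem_univ, true_and, IsBaseTuple, not_forall] at hB
    obtain ⟨g, hgM, hg, hg1⟩ := hB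
    obtain ⟨x, hx⟩ : ∃ x, g x ≠ x := by
      by_contra! h
      exact hg1 (Equiv.ext h)
    simp only [Finset.mem_biUnion, Finset.mem_filter, Finset.mem_univ, true_and, E]
    exact ⟨(x, g x), hx.symm, fun j => ⟨g, hgM, fun i => hg _, rfl⟩⟩
  have hE : ∀ p ∈ Finset.univ.filter fun p : X × X => p.1 ≠ p.2,
      ((E p).card : ℝ) ≤ (1 - δ) ^ l * (Fintype.card X : ℝ) ^ Fintype.card (Fin l × ι) := by
    rintro ⟨x, y⟩ hp
    have hxy : x ≠ y := by simpa using hp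
    have h1 : (E (x, y)).card =
        (Finset.univ.filter fun t : ι → X => SameOrbitFixing M t x y).card ^ l := by
      rw [← Fintype.card_piFinset_const]
      refine Finset.card_equiv (Equiv.curry _ _ _) fun B => ?_
      simp only [E, Fintype.mem_piFinset, Finset.mem_filter, Finset.mem_univ, true_and]
      rfl
    have h2 : ((Finset.univ.filter fun t : ι → X => SameOrbitFixing M t x y).card : ℝ) ≤
        (1 - δ) * (Fintype.card X : ℝ) ^ Fintype.card ι := by
      have h3 := Finset.card_filter_add_card_filter_not (s := (Finset.univ : Finset (ι → X)))
        (fun t => SameOrbitFixing M t x y)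
      rw [Finset.card_univ, Fintype.card_fun] at h3
      have h4 : ((Finset.univ.filter fun t : ι → X => SameOrbitFixing M t x y).card : ℝ) +
        (Finset.univ.filter fun t : ι → X => ¬ SameOrbitFixing M t x y).card =
        (Fintype.card X : ℝ) ^ Fintype.card ι := by exact_mod_cast h3
      linarith [hsep x y hxy]
    rw [h1, Nat.cast_pow, Fintype.card_prod, Fintype.card_fin, mul_comm l, pow_mul, ← mul_pow]
    gcongr
  calc ((Finset.univ.filter fun B : Fin l × ι → X => ¬ IsBaseTuple M B).card : ℝ)
      ≤ ∑ p ∈ Finset.univ.filter fun p : X × X => p.1 ≠ p.2, ((E p).card : ℝ) := by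
        exact_mod_cast (Finset.card_le_card hsub).trans Finset.card_biUnion_le
    _ ≤ ∑ p ∈ Finset.univ.filter fun p : X × X => p.1 ≠ p.2,
        (1 - δ) ^ l * (Fintype.card X : ℝ) ^ Fintype.card (Fin l × ι) := Finset.sum_le_sum hE
    _ = ((Finset.univ.filter fun p : X × X => p.1 ≠ p.2).card : ℝ) *
        ((1 - δ) ^ l * (Fintype.card X : ℝ) ^ Fintype.card (Fin l × ι)) := by
        rw [Finset.sum_const, nsmul_eq_mul]
    _ ≤ (Fintype.card X : ℝ) ^ 2 *
        ((1 - δ) ^ l * (Fintype.card X : ℝ) ^ Fintype.card (Fin l × ι)) := by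
        have h1 : 0 ≤ 1 - δ := sub_nonneg.mpr hδ
        have h2 := Finset.card_le_univ (Finset.univ.filter fun p : X × X => p.1 ≠ p.2)
        rw [Fintype.card_prod, ← pow_two] at h2
        gcongr
        exact_mod_cast h2
    _ = _ := by ring

/-- The pairs `(a, b)` and `(c, d)` lie in the same orbital of `M`. -/
def SameOrbital {X : Type*} (M : Subgroup (Equiv.Perm X)) (a b c d : X) : Prop :=
  ∃ g ∈ M, g a = c ∧ g b = d

namespace SameOrbital

variable {X : Type*} {M : Subgroup (Equiv.Perm X)} {a b c d e f : X}

theorem refl (M : Subgroup (Equiv.Perm X)) (a b : X) : SameOrbital M a b a b :=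
  ⟨1, M.one_mem, rfl, rfl⟩

theorem symm (h : SameOrbital M a b c d) : SameOrbital M c d a b := by
  obtain ⟨g, hg, rfl, rfl⟩ := h
  exact ⟨g⁻¹, M.inv_mem hg, by simp, by simp⟩

theorem trans (h : SameOrbital M a b c d) (h' : SameOrbital M c d e f) :
    SameOrbital M a b e f := by
  obtain ⟨g, hg, rfl, rfl⟩ := h
  obtain ⟨g', hg', rfl, rfl⟩ := h'
  exact ⟨g' * g, M.mul_mem hg' hg, rfl, rfl⟩

theorem apply {g : Equiv.Perm X} (hg : g ∈ M) (a b : X) : SameOrbital M a b (g a) (g b) :=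
  ⟨g, hg, rfl, rfl⟩

theorem apply_iff {g : Equiv.Perm X} (hg : g ∈ M) :
    SameOrbital M a b (g c) (g d) ↔ SameOrbital M a b c d :=
  ⟨fun h => h.trans (apply hg c d).symm, fun h => h.trans (apply hg c d)⟩

end SameOrbital

open scoped Pointwise in
theorem IsPrimitiveSubgroup.eq_or_forall_of_equivalence {X : Type*}
    {M : Subgroup (Equiv.Perm X)} (hM : IsPrimitiveSubgroup M) {r : X → X → Prop}
    (hr : Equivalence r) (hinv : ∀ g ∈ M, ∀ x y, r x y → r (g x) (g y)) :
    (∀ x y, r x y → x = y) ∨ ∀ x y, r x y := by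
  by_cases h : ∀ x y, r x y → x = y
  · exact Or.inl h
  push Not at h
  obtain ⟨x, y, hxy, hne⟩ := h
  have hblock : MulAction.IsBlock M {z | r x z} := by
    rw [MulAction.isBlock_iff_smul_eq_of_mem]
    intro g a ha hga
    have hga' : r x ((g : Equiv.Perm X) a) := hga
    have hx : r ((g : Equiv.Perm X) x) x := hr.trans (hinv g g.2 x a ha) (hr.symm hga')
    ext z
    rw [Set.mem_smul_set_iff_inv_smul_mem]
    change r x (((g⁻¹ : M) : Equiv.Perm X) z) ↔ r x z
    have hgz : (g : Equiv.Perm X) (((g⁻¹ : M) : Equiv.Perm X) z) = z := by simp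
    constructor
    · intro h
      have := hinv g g.2 _ _ h
      rw [hgz] at this
      exact hr.trans (hr.symm hx) this
    · intro h
      have h1 := hinv _ (g⁻¹ : M).2 _ _ (hr.trans hx h)
      simpa using h1
  rcases hM.2 _ hblock with h | h
  · exact absurd (h (hr.refl x) hxy) hne
  · refine Or.inr fun a b => ?_
    have ha : a ∈ {z | r x z} := h ▸ Set.mem_univ a
    have hb : b ∈ {z | r x z} := h ▸ Set.mem_univ b
    exact hr.trans (hr.symm ha) hb

open scoped Classical in
/-- The set of points which distinguish `x` from `y` through the orbitals of `M`. -/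
noncomputable def distinguishing {X : Type*} [Fintype X] (M : Subgroup (Equiv.Perm X)) (x y : X) :
    Finset X :=
  Finset.univ.filter fun z => ¬ SameOrbital M x z y z

section distinguishing

variable {X : Type*} [Fintype X] {M : Subgroup (Equiv.Perm X)} {x y z : X}

theorem mem_distinguishing : z ∈ distinguishing M x y ↔ ¬ SameOrbital M x z y z := by
  simp [distinguishing]

theorem distinguishing_self (x : X) : distinguishing M x x = ∅ := by
  ext z
  simp [mem_distinguishing, SameOrbital.refl]

theorem distinguishing_comm (x y : X) : distinguishing M x y = distinguishing M y x := by
  ext z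
  simp only [mem_distinguishing]
  exact not_congr ⟨SameOrbital.symm, SameOrbital.symm⟩

theorem card_distinguishing_triangle (x y z : X) :
    (distinguishing M x z).card ≤ (distinguishing M x y).card + (distinguishing M y z).card := by
  classical
  refine (Finset.card_le_card fun w hw => ?_).trans (Finset.card_union_le _ _)
  rw [Finset.mem_union]
  by_contra! h
  simp only [mem_distinguishing, not_not] at h hw
  exact hw (h.1.trans h.2)

theorem card_distinguishing_eq {a b c d : X} (h : SameOrbital M a b c d) :
    (distinguishing M a b).card = (distinguishing M c d).card := by
  obtain ⟨g, hg, rfl, rfl⟩ := h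
  refine Finset.card_equiv g fun z => ?_
  simp only [mem_distinguishing]
  refine not_congr ?_
  rw [SameOrbital.apply_iff hg]
  exact ⟨fun h => (SameOrbital.apply hg _ _).symm.trans h, fun h => (SameOrbital.apply hg _ _).trans h⟩

end distinguishing

theorem SimpleGraph.Connected.exists_geodesic {V : Type*} {G : SimpleGraph V} (hG : G.Connected)
    (u v : V) : ∃ f : ℕ → V, f 0 = u ∧ f (G.dist u v) = v ∧
      (∀ i < G.dist u v, G.Adj (f i) (f (i + 1))) ∧
      ∀ i j, i ≤ j → j ≤ G.dist u v → G.dist (f i) (f j) = j - i := by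
  obtain ⟨p, hp⟩ := hG.exists_walk_length_eq_dist u v
  have hadj : ∀ i < G.dist u v, G.Adj (p.getVert i) (p.getVert (i + 1)) := fun i hi =>
    p.adj_getVert_succ (hp ▸ hi)
  have hle : ∀ i j, i ≤ j → j ≤ G.dist u v → G.dist (p.getVert i) (p.getVert j) ≤ j - i := by
    intro i j hij
    induction j, hij using Nat.le_induction with
    | base => simp
    | succ j hij ih =>
      intro hj
      have h1 := hG.dist_triangle (u := p.getVert i) (v := p.getVert j) (w := p.getVert (j + 1))
      have h2 := SimpleGraph.dist_eq_one_iff_adj.mpr (hadj j hj)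
      have h3 := ih (by omega)
      omega
  have h0 : p.getVert 0 = u := p.getVert_zero
  have hd : p.getVert (G.dist u v) = v := hp ▸ p.getVert_length
  refine ⟨p.getVert, h0, hd, hadj, fun i j hij hj => ?_⟩
  have h1 := hle 0 i (by omega) (by omega)
  have h2 := hle j _ hj le_rfl
  have h3 := hle i j hij hj
  rw [h0] at h1
  rw [hd] at h2
  have h4 := hG.dist_triangle (u := u) (v := p.getVert i) (w := v)
  have h5 := hG.dist_triangle (u := p.getVert i) (v := p.getVert j) (w := v)
  omega

/-- The graph joining the pairs in the orbital of `(a, b)`. -/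
def orbitalGraph {X : Type*} (M : Subgroup (Equiv.Perm X)) (a b : X) : SimpleGraph X :=
  SimpleGraph.fromRel (SameOrbital M a b)

section orbitalGraph

variable {X : Type*} {M : Subgroup (Equiv.Perm X)} {a b : X}

theorem orbitalGraph_adj_apply_iff {g : Equiv.Perm X} (hg : g ∈ M) {u v : X} :
    (orbitalGraph M a b).Adj (g u) (g v) ↔ (orbitalGraph M a b).Adj u v := by
  simp [orbitalGraph, SameOrbital.apply_iff hg]

theorem orbitalGraph_dist_apply {g : Equiv.Perm X} (hg : g ∈ M) (u v : X) :
    (orbitalGraph M a b).dist (g u) (g v) = (orbitalGraph M a b).dist u v := by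
  have key : ∀ h ∈ M, ∀ u v, (orbitalGraph M a b).edist (h u) (h v) ≤
      (orbitalGraph M a b).edist u v := by
    intro h hh u v
    let φ : orbitalGraph M a b →g orbitalGraph M a b :=
      ⟨h, fun h' => (orbitalGraph_adj_apply_iff hh).mpr h'⟩
    refine le_iInf fun w => (SimpleGraph.edist_le (w.map φ)).trans ?_
    simp
  have h2 : (orbitalGraph M a b).edist u v ≤ (orbitalGraph M a b).edist (g u) (g v) := by
    simpa using key g⁻¹ (M.inv_mem hg) (g u) (g v)
  rw [SimpleGraph.dist, SimpleGraph.dist, le_antisymm (key g hg u v) h2]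

theorem SameOrbital.dist_orbitalGraph_eq {u v w z : X} (h : SameOrbital M u v w z) :
    (orbitalGraph M a b).dist u v = (orbitalGraph M a b).dist w z := by
  obtain ⟨g, hg, rfl, rfl⟩ := h
  exact (orbitalGraph_dist_apply hg u v).symm

theorem orbitalGraph_connected (hM : IsPrimitiveSubgroup M) (hab : a ≠ b) :
    (orbitalGraph M a b).Connected := by
  have hadj : (orbitalGraph M a b).Adj a b := by
    simp [orbitalGraph, hab, SameOrbital.refl]
  have := hM.eq_or_forall_of_equivalence (r := (orbitalGraph M a b).Reachable)
    ⟨fun _ => .refl _, fun h => h.symm, fun h h' => h.trans h'⟩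
    fun g hg x y h => h.map
      (⟨g, fun h => (orbitalGraph_adj_apply_iff hg).mpr h⟩ :
        orbitalGraph M a b →g orbitalGraph M a b)
  have hpre : (orbitalGraph M a b).Preconnected :=
    (this.resolve_left fun h => hab (h a b hadj.reachable))
  exact { preconnected := hpre, nonempty := ⟨a⟩ }

variable [Fintype X]

theorem card_distinguishing_of_adj {u v : X} (h : (orbitalGraph M a b).Adj u v) :
    (distinguishing M u v).card = (distinguishing M a b).card := by
  rw [orbitalGraph, SimpleGraph.fromRel_adj] at h
  rcases h.2 with h | h
  · exact (card_distinguishing_eq h).symm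
  · rw [distinguishing_comm]
    exact (card_distinguishing_eq h).symm

theorem card_distinguishing_le_dist_mul (hM : IsPrimitiveSubgroup M) (hab : a ≠ b) (u v : X) :
    (distinguishing M u v).card ≤
      (orbitalGraph M a b).dist u v * (distinguishing M a b).card := by
  obtain ⟨p, hp⟩ := (orbitalGraph_connected hM hab).exists_walk_length_eq_dist u v
  rw [← hp]
  clear hp
  induction p with
  | nil => simp [distinguishing_self]
  | @cons u v w h p ih =>
    refine (card_distinguishing_triangle u v w).trans ?_
    rw [card_distinguishing_of_adj h, SimpleGraph.Walk.length_cons, add_mul, one_mul, add_comm]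
    exact Nat.add_le_add_right ih _

theorem dist_le_card_distinguishing (hM : IsPrimitiveSubgroup M) (hab : a ≠ b) (u v : X) :
    (orbitalGraph M a b).dist u v ≤ (distinguishing M a b).card := by
  classical
  have hG := orbitalGraph_connected hM hab
  set G := orbitalGraph M a b
  obtain ⟨f, h0, -, hadj, hf⟩ := hG.exists_geodesic u v
  rcases Nat.eq_zero_or_pos (G.dist u v) with hd | hd
  · omega
  rw [← card_distinguishing_of_adj (hadj 0 hd), ← Nat.add_sub_cancel (n := G.dist u v) (m := 1),
    ← Nat.card_Icc 1 (G.dist u v)]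
  refine Finset.card_le_card_of_injOn f (fun i hi => ?_) fun i hi j hj hij => ?_
  · rw [Finset.coe_Icc, Set.mem_Icc] at hi
    rw [Finset.mem_coe, mem_distinguishing]
    intro h
    have h1 := h.dist_orbitalGraph_eq (a := a) (b := b)
    have h2 := hf 0 i (by omega) hi.2
    have h3 := hf 1 i (by omega) hi.2
    rw [zero_add] at h1
    change G.dist _ _ = G.dist _ _ at h1
    omega
  · rw [Finset.coe_Icc, Set.mem_Icc] at hi hj
    have h2 := hf 0 i (by omega) hi.2
    have h3 := hf 0 j (by omega) hj.2
    rw [hij] at h2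
    omega

end orbitalGraph

section uniprimitive

variable {X : Type*} [Fintype X] {M : Subgroup (Equiv.Perm X)} {a b u v : X}

open scoped Classical in
/-- In a primitive group, if some orbital covers more than two thirds of all pairs and its pairs
are at distance at least three in an orbital graph, then the distinguishing number of that
orbital is large. -/
theorem card_lt_of_three_le_dist (hM : IsPrimitiveSubgroup M) (hab : a ≠ b)
    (h3 : 3 ≤ (orbitalGraph M a b).dist u v)
    (hR : 2 * Fintype.card X < 3 * (Finset.univ.filter fun z => SameOrbital M u v u z).card) :
    2 * Fintype.card X < 9 * (distinguishing M a b).card ^ 2 := by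
  have hG := orbitalGraph_connected hM hab
  have hk : (Finset.univ.filter fun z => (orbitalGraph M a b).Adj u z).card ≤
      3 * (distinguishing M a b).card := by
    obtain ⟨f, hf0, -, -, hf⟩ := hG.exists_geodesic u v
    have hd := hf 0 3 (by omega) h3
    rw [hf0] at hd
    have h1 := card_distinguishing_le_dist_mul hM hab u (f 3)
    rw [hd] at h1
    refine (Finset.card_le_card fun z hz => ?_).trans h1
    rw [mem_distinguishing]
    intro h
    have hz' := (Finset.mem_filter.mp hz).2
    have h2 := SimpleGraph.dist_eq_one_iff_adj.mpr hz'
    have h4 := h.dist_orbitalGraph_eq (a := a) (b := b)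
    have h5 := hG.dist_triangle (u := u) (v := z) (w := f 3)
    rw [SimpleGraph.dist_comm (u := z)] at h5
    omega
  have hcount : (Finset.univ.filter fun z => SameOrbital M u v u z).card ≤
      (Finset.univ.filter fun z => (orbitalGraph M a b).Adj u z).card *
        (distinguishing M a b).card := by
    have hsub : (Finset.univ.filter fun z => SameOrbital M u v u z) ⊆
        (Finset.univ.filter fun z => (orbitalGraph M a b).Adj u z).biUnion
          fun w => distinguishing M u w := by
      intro z hz
      have hz' := ((Finset.mem_filter.mp hz).2).dist_orbitalGraph_eq (a := a) (b := b)
      obtain ⟨f, hf0, hf1, hadj, hf⟩ := hG.exists_geodesic u z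
      rw [Finset.mem_biUnion]
      refine ⟨f 1, ?_, ?_⟩
      · rw [Finset.mem_filter, ← hf0]
        refine ⟨Finset.mem_univ _, hadj 0 (by omega)⟩
      · rw [mem_distinguishing]
        intro h
        have h1 := h.dist_orbitalGraph_eq (a := a) (b := b)
        have h2 := hf 1 _ (by omega) le_rfl
        rw [hf1] at h2
        omega
    refine (Finset.card_le_card hsub).trans (Finset.card_biUnion_le.trans ?_)
    rw [Finset.sum_congr rfl (g := fun _ => (distinguishing M a b).card), Finset.sum_const,
      smul_eq_mul]
    exact fun w hw => card_distinguishing_of_adj (Finset.mem_filter.mp hw).2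
  nlinarith

open scoped Classical in
theorem exists_large_orbital [Nonempty X]
    (h : ∀ u v, 3 * (distinguishing M u v).card < Fintype.card X) :
    ∃ u z, 2 * Fintype.card X < 3 * (Finset.univ.filter fun v => SameOrbital M u z v z).card := by
  by_contra! hc
  have h1 : ∀ u z, Fintype.card X ≤
      3 * (Finset.univ.filter fun v => ¬ SameOrbital M u z v z).card := by
    intro u z
    have := Finset.card_filter_add_card_filter_not (s := Finset.univ)
      (fun v => SameOrbital M u z v z)
    rw [Finset.card_univ] at this
    have := hc u z
    omega
  let u : X := Classical.arbitrary X
  have h2 : ∑ v, (distinguishing M u v).card =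
      ∑ z, (Finset.univ.filter fun v => ¬ SameOrbital M u z v z).card := by
    simp only [distinguishing, Finset.card_filter]
    exact Finset.sum_comm
  have h3 : ∑ v, 3 * (distinguishing M u v).card < ∑ _v : X, Fintype.card X :=
    Finset.sum_lt_sum_of_nonempty Finset.univ_nonempty fun v _ => h u v
  have h4 : ∑ _v : X, Fintype.card X ≤
      ∑ z, 3 * (Finset.univ.filter fun v => ¬ SameOrbital M u z v z).card :=
    Finset.sum_le_sum fun z _ => h1 u z
  rw [← Finset.mul_sum] at h3 h4
  omega

open scoped Classical in
/-- Babai's bound: in a primitive group that is not doubly transitive, any two points are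
distinguished by at least `√n / 4` points. -/
theorem card_le_mul_card_distinguishing_sq (hM : IsPrimitiveSubgroup M)
    (h2 : ¬ ∀ a b c d : X, a ≠ b → c ≠ d → SameOrbital M a b c d) (hab : a ≠ b) :
    Fintype.card X ≤ 16 * (distinguishing M a b).card ^ 2 := by
  set d := (distinguishing M a b).card
  set n := Fintype.card X with hn
  have : Nonempty X := ⟨a⟩
  by_cases hsmall : ∀ u v, 3 * (distinguishing M u v).card < n
  swap
  · push Not at hsmall
    obtain ⟨u, v, huv⟩ := hsmall
    have h3 := card_distinguishing_le_dist_mul hM hab u v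
    have h4 := Nat.mul_le_mul_right d (dist_le_card_distinguishing hM hab u v)
    nlinarith
  have hn2 : 1 < n := Fintype.one_lt_card_iff.mpr ⟨a, b, hab⟩
  obtain ⟨u₀, z₀, hR⟩ := exists_large_orbital hsmall
  let R : X → X → Prop := fun w z => SameOrbital M u₀ z₀ w z
  have hRinv : ∀ g ∈ M, ∀ w z, R (g w) (g z) ↔ R w z := fun g hg w z =>
    SameOrbital.apply_iff hg
  let N : X → Finset X := fun z => Finset.univ.filter fun w => ¬ R w z
  let N' : X → Finset X := fun w => Finset.univ.filter fun z => ¬ R w z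
  have hNc : ∀ z z', (N z).card = (N z').card := by
    intro z z'
    obtain ⟨⟨g, hg⟩, hgz⟩ := hM.1.exists_smul_eq z z'
    have hgz : g z = z' := hgz
    refine Finset.card_equiv g fun w => ?_
    simp only [N, Finset.mem_filter, Finset.mem_univ, true_and, ← hgz, hRinv g hg]
  have hNc' : ∀ z z', (N' z).card = (N' z').card := by
    intro z z'
    obtain ⟨⟨g, hg⟩, hgz⟩ := hM.1.exists_smul_eq z z'
    have hgz : g z = z' := hgz
    refine Finset.card_equiv g fun w => ?_
    simp only [N', Finset.mem_filter, Finset.mem_univ, true_and, ← hgz, hRinv g hg]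
  set ρ := (N z₀).card with hρ
  have hρ' : ∀ u, (N' u).card = ρ := by
    intro u
    have h3 : ∑ w, (N' w).card = ∑ z, (N z).card := by
      simp only [N, N', Finset.card_filter]
      exact Finset.sum_comm
    rw [Finset.sum_congr rfl fun w _ => hNc' w u, Finset.sum_congr rfl fun w _ => hNc w z₀,
      Finset.sum_const, Finset.sum_const, Finset.card_univ, smul_eq_mul, smul_eq_mul] at h3
    exact Nat.eq_of_mul_eq_mul_left (by omega) h3
  have hRc : (Finset.univ.filter fun v => R v z₀).card + ρ = n := by
    rw [hρ, hn, ← Finset.card_univ]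
    exact Finset.card_filter_add_card_filter_not _
  have hR' : 2 * n < 3 * (Finset.univ.filter fun v => R v z₀).card := hR
  have hirr : ∀ z, ¬ R z z := by
    intro z hz
    have hsub : (Finset.univ.filter fun v => R v z₀) ⊆ {z₀} := by
      intro w hw
      obtain ⟨g, -, h3, h4⟩ := hz.symm.trans (Finset.mem_filter.mp hw).2
      rw [Finset.mem_singleton, ← h3, ← h4]
    have := Finset.card_le_card hsub
    rw [Finset.card_singleton] at this
    omega
  set μ := (N' z₀ ∩ N' u₀).card with hμ
  have hμR : ∀ u v, R v u → (N' u ∩ N' v).card = μ := by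
    rintro u v ⟨g, hg, rfl, rfl⟩
    refine (Finset.card_equiv g fun w => ?_).symm
    simp only [N', Finset.mem_inter, Finset.mem_filter, Finset.mem_univ, true_and, hRinv g hg]
  have hsum : ∀ u, ∑ v, (N' u ∩ N' v).card = ρ * ρ := by
    intro u
    have h3 : ∑ v, (N' u ∩ N' v).card = ∑ z ∈ N' u, (N z).card := by
      have : ∀ v, N' u ∩ N' v = (N' u).filter fun z => ¬ R v z := by
        intro v; ext z; simp [N']
      simp only [this, N, Finset.card_filter]
      exact Finset.sum_comm
    rw [h3, Finset.sum_congr rfl fun w _ => hNc w z₀, Finset.sum_const, smul_eq_mul, hρ' u]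
  have hμρ : 2 * μ ≤ ρ := by
    have h3 : (Finset.univ.filter fun v => R v z₀).card * μ ≤ ρ * ρ := by
      rw [← hsum z₀, ← smul_eq_mul]
      refine (Finset.card_nsmul_le_sum _ _ _ fun v hv => ?_).trans
        (Finset.sum_le_sum_of_subset (Finset.subset_univ _))
      exact (hμR z₀ v (Finset.mem_filter.mp hv).2).ge
    by_contra! hc
    nlinarith
  have hdist : ρ ≤ 2 * (distinguishing M z₀ u₀).card := by
    have hsub : N' u₀ \ N' z₀ ⊆ distinguishing M z₀ u₀ := by
      intro z hz
      simp only [N', Finset.mem_sdiff, Finset.mem_filter, Finset.mem_univ, true_and, not_not] at hz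
      rw [mem_distinguishing]
      exact fun h => hz.1 (hz.2.trans h)
    have h3 := Finset.card_le_card hsub
    have h4 := Finset.card_sdiff_add_card_inter (N' u₀) (N' z₀)
    rw [Finset.inter_comm, ← hμ, hρ'] at h4
    omega
  have hnρ : n ≤ ρ * ρ := by
    rcases Nat.eq_zero_or_pos μ with h0 | h0
    · exfalso
      have hkey : ∀ u v z, ¬ R u z → ¬ R v z → ¬ R v u := by
        intro u v z hu hv hvu
        have h3 := hμR u v hvu
        rw [h0, Finset.card_eq_zero] at h3
        have : z ∈ N' u ∩ N' v := by simp [N', hu, hv]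
        rw [h3] at this
        exact absurd this (Finset.notMem_empty z)
      have hsymm : ∀ u v, ¬ R u v → ¬ R v u := fun u v h => hkey u v v h (hirr v)
      rcases hM.eq_or_forall_of_equivalence (r := fun x y => ¬ R x y)
        ⟨hirr, fun h => hsymm _ _ h, fun h h' => hkey _ _ _ (hsymm _ _ h') h⟩
        (fun g hg x y h => (hRinv g hg x y).not.mpr h) with h | h
      · refine h2 fun a b c d hab hcd => ?_
        have h3 : R a b := by_contra fun h' => hab (h a b h')
        have h4 : R c d := by_contra fun h' => hcd (h c d h')
        exact h3.symm.trans h4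
      · exact h u₀ z₀ (SameOrbital.refl M _ _)
    · rw [← hsum z₀, hn, Fintype.card_eq_sum_ones]
      refine Finset.sum_le_sum fun v _ => ?_
      by_cases hv : R v z₀
      · rw [hμR z₀ v hv]; exact h0
      · exact Finset.card_pos.mpr ⟨z₀, by simp [N', hv, hirr]⟩
  by_cases h3 : (orbitalGraph M a b).dist u₀ z₀ ≤ 2
  · have h4 := card_distinguishing_le_dist_mul hM hab u₀ z₀
    rw [distinguishing_comm] at h4
    have h5 := h4.trans (Nat.mul_le_mul_right d h3)
    have h6 : ρ ≤ 4 * d := by omega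
    nlinarith
  · have h4 := card_lt_of_three_le_dist hM hab (u := u₀) (v := z₀) (by omega) (by
      have h5 := hρ' u₀
      have h6 := Finset.card_filter_add_card_filter_not (s := Finset.univ) (fun z => R u₀ z)
      rw [Finset.card_univ] at h6
      change (Finset.univ.filter fun z => R u₀ z).card + (N' u₀).card = n at h6
      change 2 * n < 3 * (Finset.univ.filter fun z => R u₀ z).card
      omega)
    change 2 * n < 9 * d ^ 2 at h4
    nlinarith

end uniprimitive

section twoTransitive

variable {X : Type*} [Fintype X] {M : Subgroup (Equiv.Perm X)}

theorem not_alternatingGroup_le_of_isMaximalSubgroup [DecidableEq X] (hM : IsMaximalSubgroup M) :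
    ¬ alternatingGroup X ≤ M := by
  intro h
  obtain ⟨τ, hτ, hτ'⟩ := SetLike.exists_of_lt (lt_of_le_of_ne h hM.2.1.symm)
  refine hM.1 ((Subgroup.eq_top_iff' M).mpr fun σ => ?_)
  rw [Equiv.Perm.mem_alternatingGroup] at hτ'
  have hτ1 := (Int.units_eq_one_or (Equiv.Perm.sign τ)).resolve_left hτ'
  rcases Int.units_eq_one_or (Equiv.Perm.sign σ) with hσ | hσ
  · exact h (Equiv.Perm.mem_alternatingGroup.mpr hσ)
  · have h1 : σ * τ ∈ M := h (Equiv.Perm.mem_alternatingGroup.mpr (by simp [hσ, hτ1]))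
    simpa using M.mul_mem h1 (M.inv_mem hτ)

open scoped Classical in
theorem movedPoints_commutator_subset (g k : Equiv.Perm X) :
    movedPoints (g * k * g⁻¹ * k⁻¹) ⊆ (movedPoints g ∩ movedPoints k) ∪
      ((movedPoints g ∩ movedPoints k).image g ∪ (movedPoints g ∩ movedPoints k).image k) := by
  intro x hx
  simp only [Finset.mem_union, Finset.mem_inter, Finset.mem_image]
  simp only [mem_movedPoints] at hx ⊢
  by_contra! hc
  obtain ⟨h1, h2, h3⟩ := hc
  refine hx ?_
  simp only [Equiv.Perm.mul_apply]
  by_cases hkx : k x = x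
  · have e1 : k⁻¹ x = x := by rw [Equiv.Perm.inv_eq_iff_eq, hkx]
    rw [e1]
    by_cases hy : k (g⁻¹ x) = g⁻¹ x
    · rw [hy]; simp
    · by_cases hy' : g (g⁻¹ x) = g⁻¹ x
      · have e2 : g⁻¹ x = x := by simpa using hy'.symm
        rw [e2, hkx]
        simpa [e2] using hy'
      · exact absurd (by simp) (h2 (g⁻¹ x) ⟨hy', hy⟩)
  · have hgx : g x = x := by_contra fun h => hkx (h1 h)
    by_cases hz : g (k⁻¹ x) = k⁻¹ x
    · have e2 : g⁻¹ (k⁻¹ x) = k⁻¹ x := by rw [Equiv.Perm.inv_eq_iff_eq, hz]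
      rw [e2]
      simpa using hgx
    · by_cases hz' : k (k⁻¹ x) = k⁻¹ x
      · refine absurd ?_ hkx
        have e2 : k⁻¹ x = x := by simpa using hz'.symm
        simpa [e2] using hz'
      · exact absurd (by simp) (h3 (k⁻¹ x) ⟨hz, hz'⟩)

open scoped Classical in
theorem card_movedPoints_commutator_le (g k : Equiv.Perm X) :
    (movedPoints (g * k * g⁻¹ * k⁻¹)).card ≤ 3 * (movedPoints g ∩ movedPoints k).card := by
  have h1 := Finset.card_le_card (movedPoints_commutator_subset g k)
  have h2 := Finset.card_union_le (movedPoints g ∩ movedPoints k)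
    ((movedPoints g ∩ movedPoints k).image g ∪ (movedPoints g ∩ movedPoints k).image k)
  have h3 := Finset.card_union_le ((movedPoints g ∩ movedPoints k).image g)
    ((movedPoints g ∩ movedPoints k).image k)
  have h4 := Finset.card_image_le (s := movedPoints g ∩ movedPoints k) (f := g)
  have h5 := Finset.card_image_le (s := movedPoints g ∩ movedPoints k) (f := k)
  omega

open scoped Classical in
theorem movedPoints_conj (g h : Equiv.Perm X) :
    movedPoints (h * g * h⁻¹) = (movedPoints g).image h := by
  ext x
  simp only [Finset.mem_image, mem_movedPoints, Equiv.Perm.mul_apply]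
  constructor
  · intro hx
    exact ⟨h⁻¹ x, fun h' => hx (by rw [h']; simp), by simp⟩
  · rintro ⟨y, hy, rfl⟩
    simpa using hy

theorem movedPoints_nonempty {g : Equiv.Perm X} (hg : g ≠ 1) : (movedPoints g).Nonempty := by
  by_contra hc
  rw [Finset.not_nonempty_iff_eq_empty] at hc
  refine hg (Equiv.ext fun x => by_contra fun hx => ?_)
  have : x ∈ movedPoints g := mem_movedPoints.mpr hx
  simp [hc] at this

open scoped Classical in
/-- A primitive group containing a nontrivial element that moves at most three points contains the
alternating group. -/
theorem IsPrimitiveSubgroup.alternatingGroup_le_of_card_movedPoints_le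
    (hM : IsPrimitiveSubgroup M) {g : Equiv.Perm X} (hg : g ∈ M) (hg1 : g ≠ 1)
    (h3 : (movedPoints g).card ≤ 3) : alternatingGroup X ≤ M := by
  have hprim : MulAction.IsPreprimitive M X :=
    { toIsPretransitive := hM.1, isTrivialBlock_of_isBlock := fun h => hM.2 _ h }
  have hsupp : g.support = movedPoints g := by
    ext x
    rw [Equiv.Perm.mem_support, mem_movedPoints]
  rw [← hsupp] at h3
  have h2 := Equiv.Perm.two_le_card_support_of_ne_one hg1
  rcases h2.lt_or_eq with h | h
  · exact Equiv.Perm.alternatingGroup_le_of_isPreprimitive_of_isThreeCycle_mem hprim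
      (card_support_eq_three_iff.mp (by omega)) hg
  · rw [Equiv.Perm.subgroup_eq_top_of_isPreprimitive_of_isSwap_mem hprim g
      (Equiv.Perm.card_support_eq_two.mp h.symm) hg]
    exact le_top

open scoped Classical in
/-- In a doubly transitive group, the elements fixing `a` that map `x` to `y` are equally many
for all `x` and `y` different from `a`. -/
theorem card_stabilizer_apply_eq
    (h2 : ∀ a b c d : X, a ≠ b → c ≠ d → SameOrbital M a b c d) {a x y x' y' : X}
    (hx : x ≠ a) (hy : y ≠ a) (hx' : x' ≠ a) (hy' : y' ≠ a) :
    (Finset.univ.filter fun h : M => (h : Equiv.Perm X) a = a ∧ (h : Equiv.Perm X) x = y).card =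
    (Finset.univ.filter fun h : M =>
      (h : Equiv.Perm X) a = a ∧ (h : Equiv.Perm X) x' = y').card := by
  obtain ⟨u, hu, hua, hux⟩ := h2 a x a x' hx.symm hx'.symm
  obtain ⟨v, hv, hva, hvy⟩ := h2 a y a y' hy.symm hy'.symm
  have hua' : u⁻¹ a = a := by rw [Equiv.Perm.inv_eq_iff_eq, hua]
  have hux' : u⁻¹ x' = x := by rw [Equiv.Perm.inv_eq_iff_eq, hux]
  refine Finset.card_equiv ((Equiv.mulLeft (⟨v, hv⟩ : M)).trans
    (Equiv.mulRight (⟨u, hu⟩ : M)⁻¹)) fun h => ?_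
  simp only [Finset.mem_filter, Finset.mem_univ, true_and, Equiv.trans_apply,
    Equiv.coe_mulLeft, Equiv.coe_mulRight, Subgroup.coe_mul, Subgroup.coe_inv,
    Equiv.Perm.mul_apply, hua', hux']
  refine and_congr ?_ ?_
  · exact ⟨fun h' => by rw [h', hva], fun h' => v.injective (h'.trans hva.symm)⟩
  · exact ⟨fun h' => by rw [h', hvy], fun h' => v.injective (h'.trans hvy.symm)⟩

open scoped Classical in
theorem exists_card_inter_image_le
    (h2 : ∀ a b c d : X, a ≠ b → c ≠ d → SameOrbital M a b c d) {S : Finset X} {a b : X}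
    (hb : b ≠ a) (hS : S ≠ Finset.univ) (ha : a ∈ S) :
    ∃ h ∈ M, h a = a ∧ h b ∉ S ∧
      (Fintype.card X - S.card) * ((S ∩ S.image h).card - 1) ≤ (S.card - 1) ^ 2 := by
  let H : Finset M := Finset.univ.filter fun h => (h : Equiv.Perm X) a = a
  let C : X → X → Finset M := fun x y =>
    Finset.univ.filter fun h => (h : Equiv.Perm X) a = a ∧ (h : Equiv.Perm X) x = y
  set c := (C b b).card with hc
  have hcC : ∀ x y, x ≠ a → y ≠ a → (C x y).card = c := fun x y hx hy =>
    card_stabilizer_apply_eq h2 hx hy hb hb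
  have hc0 : 0 < c := Finset.card_pos.mpr ⟨1, by simp [C]⟩
  let J : Finset M := H.filter fun h => (h : Equiv.Perm X) b ∉ S
  have hJ : J.card = (Fintype.card X - S.card) * c := by
    have : J = Sᶜ.biUnion fun y => C b y := by
      ext h
      simp [J, H, C, and_comm]
    rw [this, Finset.card_biUnion, Finset.sum_congr rfl fun y hy => hcC b y hb ?_,
      Finset.sum_const, Finset.card_compl, smul_eq_mul]
    · rintro rfl
      exact (Finset.mem_compl.mp hy) ha
    · intro y _ z _ hyz
      refine Finset.disjoint_left.mpr fun h h1 h2 => hyz ?_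
      rw [← (Finset.mem_filter.mp h1).2.2, (Finset.mem_filter.mp h2).2.2]
  have hsum : ∑ h ∈ H, ((S ∩ S.image (h : Equiv.Perm X)).card - 1) ≤ (S.card - 1) ^ 2 * c := by
    have h3 : ∀ h ∈ H, (S ∩ S.image (h : Equiv.Perm X)).card - 1 ≤
        ∑ p ∈ (S.erase a) ×ˢ (S.erase a), if (h : Equiv.Perm X) p.1 = p.2 then 1 else 0 := by
      intro h hh
      have hha : (h : Equiv.Perm X) a = a := (Finset.mem_filter.mp hh).2
      rw [← Finset.card_filter, ← Finset.card_erase_of_mem (a := a)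
        (Finset.mem_inter.mpr ⟨ha, Finset.mem_image.mpr ⟨a, ha, hha⟩⟩)]
      refine Finset.card_le_card_of_injOn (fun y => ((h : Equiv.Perm X)⁻¹ y, y)) ?_ ?_
      · intro y hy
        simp only [Finset.coe_erase, Finset.coe_inter, Finset.coe_image, Set.mem_sdiff,
          Set.mem_inter_iff, Finset.mem_coe, Set.mem_image, Set.mem_singleton_iff] at hy
        obtain ⟨⟨hyS, x, hxS, rfl⟩, hya⟩ := hy
        have hxa : x ≠ a := by rintro rfl; exact hya hha
        simp [hxS, hyS, hxa, hya]
      · intro y _ z _ hyz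
        exact congrArg Prod.snd hyz
    refine (Finset.sum_le_sum h3).trans ?_
    rw [Finset.sum_comm, Finset.sum_congr rfl (g := fun _ => c), Finset.sum_const,
      Finset.card_product, Finset.card_erase_of_mem ha, smul_eq_mul, pow_two]
    rintro ⟨x, y⟩ hxy
    simp only [Finset.mem_product, Finset.mem_erase] at hxy
    rw [← hcC x y hxy.1.1 hxy.2.1, ← Finset.card_filter, Finset.filter_filter]
  have hn : 0 < Fintype.card X - S.card :=
    Nat.sub_pos_of_lt ((Finset.card_lt_iff_ne_univ S).mpr hS)
  by_contra! hcon
  have h4 : J.card * ((S.card - 1) ^ 2 + 1) ≤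
      ∑ h ∈ J, (Fintype.card X - S.card) * ((S ∩ S.image (h : Equiv.Perm X)).card - 1) := by
    rw [← smul_eq_mul]
    refine Finset.card_nsmul_le_sum _ _ _ fun h hh => ?_
    simp only [J, H, Finset.mem_filter, Finset.mem_univ, true_and] at hh
    exact hcon h h.2 hh.1 hh.2
  have h5 : ∑ h ∈ J, ((S ∩ S.image (h : Equiv.Perm X)).card - 1) ≤ (S.card - 1) ^ 2 * c :=
    (Finset.sum_le_sum_of_subset (Finset.filter_subset _ _)).trans hsum
  rw [← Finset.mul_sum, hJ, mul_assoc] at h4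
  have h6 := Nat.le_of_mul_le_mul_left (h4.trans (Nat.mul_le_mul_left _ h5)) hn
  nlinarith

open scoped Classical in
/-- A nontrivial element of a doubly transitive group not containing the alternating group moves
more than an eighth of the points. -/
theorem card_lt_mul_card_movedPoints (hM : IsPrimitiveSubgroup M)
    (h2 : ∀ a b c d : X, a ≠ b → c ≠ d → SameOrbital M a b c d)
    (hA : ¬ alternatingGroup X ≤ M) {g : Equiv.Perm X} (hg : g ∈ M) (hg1 : g ≠ 1) :
    Fintype.card X < 8 * (movedPoints g).card := by
  obtain ⟨g₀, hg₀, hmin⟩ := Finset.exists_min_image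
    (Finset.univ.filter fun g : Equiv.Perm X => g ∈ M ∧ g ≠ 1) (fun g => (movedPoints g).card)
    ⟨g, by simp [hg, hg1]⟩
  have hle := hmin g (by simp [hg, hg1])
  simp only [Finset.mem_filter, Finset.mem_univ, true_and, and_imp] at hmin hg₀
  refine lt_of_lt_of_le ?_ (Nat.mul_le_mul_left 8 hle)
  by_contra! hc
  set S := movedPoints g₀ with hS
  obtain ⟨a, ha⟩ := movedPoints_nonempty hg₀.2
  have hSpos : 0 < S.card := Finset.card_pos.mpr ⟨a, ha⟩
  obtain ⟨h, hh, hha, hhb, hcard⟩ := exists_card_inter_image_le h2 (S := S) (a := a) (b := g₀ a)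
    (mem_movedPoints.mp ha) (fun h => by rw [h, Finset.card_univ] at hc hSpos; omega) ha
  set k := h * g₀ * h⁻¹ with hk
  have hkM : k ∈ M := M.mul_mem (M.mul_mem hh hg₀.1) (M.inv_mem hh)
  have hcomm := card_movedPoints_commutator_le g₀ k
  have hcM : g₀ * k * g₀⁻¹ * k⁻¹ ∈ M :=
    M.mul_mem (M.mul_mem (M.mul_mem hg₀.1 hkM) (M.inv_mem hg₀.1)) (M.inv_mem hkM)
  have hka : k a = h (g₀ a) := by
    have : h⁻¹ a = a := by rw [Equiv.Perm.inv_eq_iff_eq, hha]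
    rw [hk, Equiv.Perm.mul_apply, Equiv.Perm.mul_apply, this]
  have hc1 : g₀ * k * g₀⁻¹ * k⁻¹ ≠ 1 := by
    intro h1
    rw [mul_inv_eq_one, mul_inv_eq_iff_eq_mul] at h1
    have h3 := congrArg (fun σ : Equiv.Perm X => σ a) h1
    simp only [Equiv.Perm.mul_apply] at h3
    rw [hka, not_not.mp (mt mem_movedPoints.mpr hhb), ← hka] at h3
    exact mem_movedPoints.mp ha (k.injective h3).symm
  rw [← hS, hk, movedPoints_conj, ← hk, ← hS] at hcomm
  have h3 := hmin _ hcM hc1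
  set j := (S ∩ S.image h).card - 1 with hj
  have hj0 : j = 0 := by
    by_contra hj0
    have h7 : 7 * S.card * j ≤ (S.card - 1) ^ 2 :=
      (Nat.mul_le_mul_right j (by omega)).trans hcard
    have h8 : (S.card - 1) ^ 2 ≤ S.card ^ 2 := Nat.pow_le_pow_left (Nat.sub_le _ _) 2
    have h9 : 7 * j ≤ S.card := by
      refine Nat.le_of_mul_le_mul_left ?_ hSpos
      linarith [h7.trans h8, pow_two S.card]
    omega
  exact hA (hM.alternatingGroup_le_of_card_movedPoints_le hcM hc1 (by omega))

end twoTransitive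

/-- The `ι`-tuples `s` and `t` lie in the same orbit of `M`. -/
def SameTupleOrbit {X ι : Type*} (M : Subgroup (Equiv.Perm X)) (s t : ι → X) : Prop :=
  ∃ g ∈ M, ∀ i, g (s i) = t i

namespace SameTupleOrbit

variable {X ι : Type*} {M : Subgroup (Equiv.Perm X)} {r s t : ι → X}

theorem symm (h : SameTupleOrbit M s t) : SameTupleOrbit M t s := by
  obtain ⟨g, hg, h⟩ := h
  exact ⟨g⁻¹, M.inv_mem hg, fun i => by rw [← h i]; simp⟩

theorem trans (h : SameTupleOrbit M r s) (h' : SameTupleOrbit M s t) : SameTupleOrbit M r t := by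
  obtain ⟨g, hg, h⟩ := h
  obtain ⟨g', hg', h'⟩ := h'
  exact ⟨g' * g, M.mul_mem hg' hg, fun i => by rw [Equiv.Perm.mul_apply, h, h']⟩

end SameTupleOrbit

section tuples

variable {X ι : Type*} [Fintype X] [Fintype ι] {M : Subgroup (Equiv.Perm X)}

open scoped Classical in
/-- The number of triples of tuples for which the first tuple does not allow to move an entry of
the second tuple to the corresponding entry of the third one. -/
theorem card_not_sameOrbitFixing_le {D : ℕ} (hD : ∀ x y : X,
    (Finset.univ.filter fun t : ι → X => ¬ SameOrbitFixing M t x y).card ≤ D) (i : ι) :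
    (Finset.univ.filter fun T : (ι → X) × (ι → X) × (ι → X) =>
      ¬ SameOrbitFixing M T.1 (T.2.1 i) (T.2.2 i)).card ≤
      (Fintype.card X ^ Fintype.card ι) ^ 2 * D := by
  rw [Finset.card_filter, Fintype.sum_prod_type_right]
  simp only [← Finset.card_filter]
  refine (Finset.sum_le_sum (g := fun _ => D) fun p _ => hD _ _).trans ?_
  rw [Finset.sum_const, smul_eq_mul, Finset.card_univ, Fintype.card_prod, Fintype.card_fun,
    pow_two]

/-- Replace the entries of `s` with index in `A` by the entries of `t`. -/
noncomputable def hybrid (A : Finset ι) (s t : ι → X) : ι → X :=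
  open scoped Classical in fun i => if i ∈ A then t i else s i

open scoped Classical in
theorem card_not_sameTupleOrbit_hybrid_insert_le {D : ℕ} (hD : ∀ x y : X,
    (Finset.univ.filter fun t : ι → X => ¬ SameOrbitFixing M t x y).card ≤ D)
    {A : Finset ι} {i : ι} (hi : i ∉ A) :
    (Finset.univ.filter fun T : (ι → X) × (ι → X) × (ι → X) =>
      ¬ SameTupleOrbit M (hybrid A T.1 T.2.1) (hybrid (insert i A) T.1 T.2.1)).card ≤
      (Fintype.card X ^ Fintype.card ι) ^ 2 * D := by
  refine le_trans ?_ (card_not_sameOrbitFixing_le hD i)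
  refine Finset.card_le_card_of_injOn (fun T =>
    (fun j => if j = i then T.2.2 j else if j ∈ A then T.2.1 j else T.1 j,
     fun j => if j = i then T.1 j else if j ∈ A then T.1 j else T.2.1 j,
     fun j => if j = i then T.2.1 j else T.2.2 j)) ?_ ?_
  · rintro ⟨s, t, r⟩ hT
    simp only [Finset.coe_filter, Finset.mem_univ, true_and, Set.mem_ofPred_eq, if_true] at hT ⊢
    refine fun h => hT ?_
    obtain ⟨g, hg, h1, h2⟩ := h
    refine ⟨g, hg, fun j => ?_⟩
    have h3 := h1 j
    by_cases hj : j = i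
    · subst hj
      simpa [hybrid, hi] using h2
    · simpa [hybrid, hj] using h3
  · rintro ⟨s, t, r⟩ - ⟨s', t', r'⟩ - h
    simp only [Prod.mk.injEq, funext_iff] at h ⊢
    obtain ⟨h1, h2, h3⟩ := h
    refine ⟨fun j => ?_, fun j => ?_, fun j => ?_⟩ <;>
    · have h1 := h1 j
      have h2 := h2 j
      have h3 := h3 j
      split_ifs at h1 h2 h3 <;> assumption

open scoped Classical in
theorem card_not_sameTupleOrbit_hybrid_le {D : ℕ} (hD : ∀ x y : X,
    (Finset.univ.filter fun t : ι → X => ¬ SameOrbitFixing M t x y).card ≤ D) (A : Finset ι) :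
    (Finset.univ.filter fun T : (ι → X) × (ι → X) × (ι → X) =>
      ¬ SameTupleOrbit M T.1 (hybrid A T.1 T.2.1)).card ≤
      A.card * ((Fintype.card X ^ Fintype.card ι) ^ 2 * D) := by
  induction A using Finset.induction_on with
  | empty =>
    rw [Finset.filter_eq_empty_iff.mpr]
    · simp
    · intro T _
      rw [not_not]
      exact ⟨1, M.one_mem, fun i => by simp [hybrid]⟩
  | insert i A hi ih =>
    rw [Finset.card_insert_of_notMem hi, add_mul, one_mul]
    refine le_trans (Finset.card_le_card (fun T hT => ?_)) ((Finset.card_union_le _ _).trans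
      (add_le_add ih (card_not_sameTupleOrbit_hybrid_insert_le hD hi)))
    simp only [Finset.mem_union, Finset.mem_filter, Finset.mem_univ, true_and] at hT ⊢
    by_contra! hc
    exact hT (hc.1.trans hc.2)

open scoped Classical in
/-- If a random tuple rarely separates two points, then `M` has a large orbit on tuples. -/
theorem exists_card_not_sameTupleOrbit_le [Nonempty X] {D : ℕ} (hD : ∀ x y : X,
    (Finset.univ.filter fun t : ι → X => ¬ SameOrbitFixing M t x y).card ≤ D) :
    ∃ s : ι → X, (Finset.univ.filter fun t : ι → X => ¬ SameTupleOrbit M s t).card ≤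
      Fintype.card ι * D := by
  have h := card_not_sameTupleOrbit_hybrid_le (M := M) hD Finset.univ
  have hy : ∀ s t : ι → X, hybrid Finset.univ s t = t := fun s t => funext fun i => by simp [hybrid]
  simp only [hy] at h
  have hN : 0 < Fintype.card X ^ Fintype.card ι := pow_pos Fintype.card_pos _
  set N := Fintype.card X ^ Fintype.card ι with hNdef
  have hsum : ∀ s, (∑ p : (ι → X) × (ι → X), if ¬ SameTupleOrbit M s p.1 then 1 else 0) =
      N * (Finset.univ.filter fun t : ι → X => ¬ SameTupleOrbit M s t).card := by
    intro s
    rw [Fintype.sum_prod_type, Finset.card_filter, Finset.mul_sum]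
    refine Finset.sum_congr rfl fun t _ => ?_
    refine (Finset.sum_const (if ¬ SameTupleOrbit M s t then 1 else 0)).trans ?_
    rw [Finset.card_univ, Fintype.card_fun, smul_eq_mul]
  rw [Finset.card_filter, Fintype.sum_prod_type, Finset.sum_congr rfl fun s _ => hsum s,
    ← Finset.mul_sum, Finset.card_univ] at h
  by_contra! hc
  have h1 := Finset.sum_lt_sum_of_nonempty (s := (Finset.univ : Finset (ι → X)))
    Finset.univ_nonempty fun s _ => hc s
  rw [Finset.sum_const, Finset.card_univ, Fintype.card_fun, smul_eq_mul] at h1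
  refine ((Nat.mul_lt_mul_left hN).mpr h1).not_ge (h.trans (le_of_eq ?_))
  rw [hNdef]
  ring

open scoped Classical in
theorem card_tuples_apply_eq_mul_le {i j : ι} (hij : i ≠ j) :
    (Finset.univ.filter fun t : ι → X => t i = t j).card * Fintype.card X ≤
      Fintype.card X ^ Fintype.card ι := by
  rw [← Fintype.card_fun, ← Finset.card_univ (α := X), ← Finset.card_product,
    ← Finset.card_univ]
  refine Finset.card_le_card_of_injOn (fun p => Function.update p.1 j p.2)
    (fun _ _ => Finset.mem_coe.mpr (Finset.mem_univ _)) ?_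
  rintro ⟨t, x⟩ ht ⟨t', x'⟩ ht' h
  simp only [Finset.coe_product, Set.mem_prod, Finset.mem_coe, Finset.mem_filter,
    Finset.mem_univ, true_and, and_true] at ht ht' h
  have hk : ∀ k ≠ j, t k = t' k := fun k hk => by
    simpa [Function.update_of_ne hk] using congrFun h k
  refine Prod.ext (funext fun k => ?_) (by simpa using congrFun h j)
  by_cases hkj : k = j
  · subst hkj
    exact ht.symm.trans ((hk i hij).trans ht')
  · exact hk k hkj

open scoped Classical in
theorem exists_mem_apply_eq_apply_perm [Nonempty X] {D : ℕ} (hD : ∀ x y : X,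
    (Finset.univ.filter fun t : ι → X => ¬ SameOrbitFixing M t x y).card ≤ D)
    (σ : Equiv.Perm ι) (hσ : ∀ i, σ i ≠ i)
    (hlt : 2 * Fintype.card ι * D * Fintype.card X +
      Fintype.card ι * Fintype.card X ^ Fintype.card ι <
      Fintype.card X * Fintype.card X ^ Fintype.card ι) :
    ∃ g ∈ M, ∃ t : ι → X, ∀ i, g (t i) = t (σ i) ∧ g (t i) ≠ t i := by
  obtain ⟨s, hs⟩ := exists_card_not_sameTupleOrbit_le hD
  set E₁ := Finset.univ.filter fun t : ι → X => ¬ SameTupleOrbit M s t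
  set E₂ := Finset.univ.filter fun t : ι → X => ¬ SameTupleOrbit M s (t ∘ σ) with hE₂
  let E : ι → Finset (ι → X) := fun i => Finset.univ.filter fun t : ι → X => t i = t (σ i)
  have h2 : E₂.card = E₁.card := by
    refine Finset.card_equiv (Equiv.arrowCongr σ.symm (Equiv.refl X)) fun t => ?_
    simp [E₁, E₂, Equiv.arrowCongr]
  have h3 : (Finset.univ.biUnion E).card * Fintype.card X ≤
      Fintype.card ι * Fintype.card X ^ Fintype.card ι := by
    refine (Nat.mul_le_mul_right _ Finset.card_biUnion_le).trans ?_
    rw [Finset.sum_mul]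
    refine (Finset.sum_le_card_nsmul _ _ _
      fun i _ => card_tuples_apply_eq_mul_le (hσ i).symm).trans ?_
    rw [Finset.card_univ, smul_eq_mul]
  have h4 : ∃ t, t ∉ (E₁ ∪ E₂) ∪ Finset.univ.biUnion E := by
    by_contra! hc
    have h5 := Finset.card_le_card fun t (_ : t ∈ Finset.univ) => hc t
    have h6 := (Finset.card_union_le (E₁ ∪ E₂) (Finset.univ.biUnion E))
    have h7 := Finset.card_union_le E₁ E₂
    rw [Finset.card_univ, Fintype.card_fun] at h5
    have h8 : Fintype.card X ^ Fintype.card ι ≤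
        2 * Fintype.card ι * D + (Finset.univ.biUnion E).card := by
      rw [mul_assoc]; omega
    have h9 := Nat.mul_le_mul_right (Fintype.card X) h8
    rw [add_mul] at h9
    have h10 := mul_comm (Fintype.card X) (Fintype.card X ^ Fintype.card ι)
    omega
  obtain ⟨t, ht⟩ := h4
  simp only [Finset.mem_union, Finset.mem_biUnion, not_or, not_exists, Finset.mem_filter,
    Finset.mem_univ, true_and, not_not, E₁, E₂, E] at ht
  obtain ⟨g, hg, h⟩ := ht.1.1.symm.trans ht.1.2
  refine ⟨g, hg, t, fun i => ⟨h i, ?_⟩⟩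
  rw [h i]
  exact Ne.symm (ht.2 i)

end tuples

theorem minimalPeriod_eq_of_apply_eq_finRotate {X : Type*} {g : Equiv.Perm X} {p : ℕ}
    (hp : p.Prime) {t : Fin p → X} (ht : ∀ i, g (t i) = t (finRotate p i)) (hne : ∀ i, g (t i) ≠ t i)
    (i : Fin p) : Function.minimalPeriod g (t i) = p := by
  have : Fact p.Prime := ⟨hp⟩
  refine Function.minimalPeriod_eq_prime ?_ (hne i)
  have h1 : ∀ j : ℕ, g^[j] (t i) = t ((finRotate p ^ j) i) := by
    intro j
    induction j with
    | zero => rfl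
    | succ j ih => rw [Function.iterate_succ_apply', ih, ht, pow_succ', Equiv.Perm.mul_apply]
  have h2 : finRotate p ^ p = 1 := by
    obtain ⟨m, rfl⟩ : ∃ m, p = m + 2 := ⟨p - 2, by have := hp.two_le; omega⟩
    have h3 := pow_orderOf_eq_one (finRotate (m + 2))
    rwa [isCycle_finRotate.orderOf, support_finRotate, Finset.card_univ, Fintype.card_fin] at h3
  rw [Function.IsPeriodicPt, Function.IsFixedPt, h1, h2, Equiv.Perm.one_apply]

section periods

variable {X : Type*} [Fintype X] {M : Subgroup (Equiv.Perm X)}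

theorem Equiv.Perm.minimalPeriod_le_card (g : Equiv.Perm X) (x : X) :
    Function.minimalPeriod g x ≤ Fintype.card X := by
  rw [← Finset.card_univ, ← Finset.card_range (Function.minimalPeriod g x)]
  refine Finset.card_le_card_of_injOn (fun j => g^[j] x)
    (fun _ _ => Finset.mem_coe.mpr (Finset.mem_univ _)) ?_
  rw [Finset.coe_range]
  exact Function.iterate_injOn_Iio_minimalPeriod

theorem Equiv.Perm.minimalPeriod_pos (g : Equiv.Perm X) (x : X) :
    0 < Function.minimalPeriod g x := by
  refine Function.minimalPeriod_pos_of_mem_periodicPts ⟨orderOf g, orderOf_pos g, ?_⟩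
  rw [Function.IsPeriodicPt, Function.IsFixedPt, Equiv.Perm.iterate_eq_pow, pow_orderOf_eq_one,
    Equiv.Perm.one_apply]

open scoped Classical in
/-- If all nontrivial elements of `M` move many points and some cycle of `g ∈ M` has length
divisible by the prime `p`, then many points lie in such cycles. -/
theorem card_le_mul_card_dvd_minimalPeriod {c : ℕ}
    (hmin : ∀ h ∈ M, h ≠ 1 → Fintype.card X ≤ c * (movedPoints h).card) {g : Equiv.Perm X}
    (hg : g ∈ M) {p : ℕ} (hp : p.Prime) {x₀ : X} (hx₀ : p ∣ Function.minimalPeriod g x₀) :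
    Fintype.card X ≤ c * (Finset.univ.filter fun x => p ∣ Function.minimalPeriod g x).card := by
  have hdvd : ∀ x, Function.minimalPeriod g x ∣ orderOf g := fun x => by
    refine Function.IsPeriodicPt.minimalPeriod_dvd ?_
    rw [Function.IsPeriodicPt, Function.IsFixedPt, Equiv.Perm.iterate_eq_pow, pow_orderOf_eq_one,
      Equiv.Perm.one_apply]
  obtain ⟨m, hm⟩ := hx₀.trans (hdvd x₀)
  have hm0 : 0 < m := Nat.pos_of_ne_zero fun h => by
    rw [h, mul_zero] at hm
    exact (orderOf_pos g).ne' hm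
  have hh : g ^ m ≠ 1 := fun h => by
    have := Nat.le_of_dvd hm0 (orderOf_dvd_of_pow_eq_one h)
    rw [hm] at this
    nlinarith [hp.two_le]
  refine (hmin _ (M.pow_mem hg m) hh).trans (Nat.mul_le_mul_left c (Finset.card_le_card ?_))
  intro x hx
  rw [mem_movedPoints] at hx
  refine Finset.mem_filter.mpr ⟨Finset.mem_univ _, by_contra fun hpx => hx ?_⟩
  have h1 : Function.minimalPeriod g x ∣ m :=
    ((Nat.coprime_comm.mp ((Nat.Prime.coprime_iff_not_dvd hp).mpr hpx))).dvd_of_dvd_mul_left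
      (hm ▸ hdvd x)
  have h2 := (Function.isPeriodicPt_iff_minimalPeriod_dvd (f := g)).mpr h1
  rwa [Function.IsPeriodicPt, Function.IsFixedPt, Equiv.Perm.iterate_eq_pow] at h2

/-- An element of a permutation group of large minimal degree cannot have cycle lengths divisible
by many primes. -/
theorem sum_log_le_of_dvd_minimalPeriod [Nonempty X] {c : ℕ}
    (hmin : ∀ h ∈ M, h ≠ 1 → Fintype.card X ≤ c * (movedPoints h).card) {g : Equiv.Perm X}
    (hg : g ∈ M) {P : Finset ℕ} (hP : ∀ p ∈ P, p.Prime)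
    (hdvd : ∀ p ∈ P, ∃ x, p ∣ Function.minimalPeriod g x) :
    ∑ p ∈ P, Real.log p ≤ c * Real.log (Fintype.card X) := by
  classical
  have hn : (0 : ℝ) < Fintype.card X := by exact_mod_cast Fintype.card_pos
  have hx : ∀ x, ∑ p ∈ P, (if p ∣ Function.minimalPeriod g x then Real.log p else 0) ≤
      Real.log (Fintype.card X) := by
    intro x
    rw [← Finset.sum_filter, ← Real.log_prod]
    · have h1 : ∏ p ∈ P.filter (fun p => p ∣ Function.minimalPeriod g x), p ∣
          Function.minimalPeriod g x :=
        Finset.prod_primes_dvd _ (fun p hp => (hP p (Finset.mem_filter.mp hp).1).prime)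
          fun p hp => (Finset.mem_filter.mp hp).2
      have h2 := (Nat.le_of_dvd (g.minimalPeriod_pos x) h1).trans (g.minimalPeriod_le_card x)
      rw [← Nat.cast_prod]
      refine Real.log_le_log ?_ (by exact_mod_cast h2)
      exact_mod_cast Nat.pos_of_dvd_of_pos h1 (g.minimalPeriod_pos x)
    · intro p hp
      exact_mod_cast (hP p (Finset.mem_filter.mp hp).1).ne_zero
  have h3 : ∑ p ∈ P, (Fintype.card X : ℝ) * Real.log p ≤
      ∑ p ∈ P, c * ∑ x, (if p ∣ Function.minimalPeriod g x then Real.log p else 0) := by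
    refine Finset.sum_le_sum fun p hp => ?_
    obtain ⟨x₀, hx₀⟩ := hdvd p hp
    have h4 := card_le_mul_card_dvd_minimalPeriod hmin hg (hP p hp) hx₀
    rw [← Finset.sum_filter, Finset.sum_const, nsmul_eq_mul, ← mul_assoc]
    refine mul_le_mul_of_nonneg_right (by exact_mod_cast h4) (Real.log_natCast_nonneg p)
  rw [← Finset.mul_sum, ← Finset.mul_sum, Finset.sum_comm] at h3
  have h5 := Finset.sum_le_card_nsmul Finset.univ _ _ fun x _ => hx x
  rw [Finset.card_univ, nsmul_eq_mul] at h5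
  have h6 := h3.trans (mul_le_mul_of_nonneg_left h5 (Nat.cast_nonneg c))
  refine le_of_mul_le_mul_left ?_ hn
  linarith

open scoped Classical in
theorem card_not_sameOrbitFixing_eq {ι : Type*} [Fintype ι] {x y x' y' : X}
    (h : SameOrbital M x y x' y') :
    (Finset.univ.filter fun t : ι → X => ¬ SameOrbitFixing M t x y).card =
      (Finset.univ.filter fun t : ι → X => ¬ SameOrbitFixing M t x' y').card := by
  have key : ∀ u ∈ M, ∀ x y, ∀ t : ι → X, SameOrbitFixing M t x y →
      SameOrbitFixing M (fun i => u (t i)) (u x) (u y) := by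
    rintro u hu x y t ⟨g, hg, hgt, hgx⟩
    exact ⟨u * g * u⁻¹, M.mul_mem (M.mul_mem hu hg) (M.inv_mem hu), fun i => by simp [hgt],
      by simp [hgx]⟩
  obtain ⟨u, hu, rfl, rfl⟩ := h
  refine Finset.card_equiv (Equiv.arrowCongr (Equiv.refl ι) u) fun t => ?_
  simp only [Finset.mem_filter, Finset.mem_univ, true_and]
  refine not_congr ⟨key u hu x y t, fun h => ?_⟩
  simpa [Equiv.arrowCongr] using key u⁻¹ (M.inv_mem hu) _ _ _ h

open scoped Classical in
/-- In a doubly transitive group of large minimal degree, random tuples separate points with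
substantial probability. -/
theorem lt_card_not_sameOrbitFixing {ι : Type*} [Fintype ι] [Nonempty X] {c : ℕ}
    (h2 : ∀ a b c d : X, a ≠ b → c ≠ d → SameOrbital M a b c d)
    (hmin : ∀ h ∈ M, h ≠ 1 → Fintype.card X ≤ c * (movedPoints h).card)
    {P : Finset ℕ} (hP : ∀ p ∈ P, p.Prime) (e : (Σ p : P, Fin p) ≃ ι)
    (hlog : c * Real.log (Fintype.card X) < ∑ p ∈ P, Real.log p) {D : ℕ}
    (hD : 2 * Fintype.card ι * D * Fintype.card X +
      Fintype.card ι * Fintype.card X ^ Fintype.card ι <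
      Fintype.card X * Fintype.card X ^ Fintype.card ι) {x y : X} (hxy : x ≠ y) :
    D < (Finset.univ.filter fun t : ι → X => ¬ SameOrbitFixing M t x y).card := by
  by_contra! hc
  have hD' : ∀ x' y' : X, (Finset.univ.filter fun t : ι → X =>
      ¬ SameOrbitFixing M t x' y').card ≤ D := by
    intro x' y'
    by_cases hxy' : x' = y'
    · subst hxy'
      rw [Finset.filter_eq_empty_iff.mpr fun t _ => not_not.mpr ⟨1, M.one_mem, fun _ => rfl, rfl⟩]
      simp
    · rwa [card_not_sameOrbitFixing_eq (h2 x' y' x y hxy' hxy)]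
  obtain ⟨g, hg, t, ht⟩ := exists_mem_apply_eq_apply_perm hD'
    ((e.symm.trans (Equiv.sigmaCongrRight fun p : P => finRotate p)).trans e) (by
      intro j h
      obtain ⟨⟨⟨p, hp⟩, i⟩, rfl⟩ := e.surjective j
      obtain ⟨m, rfl⟩ : ∃ m, p = m + 2 := ⟨p - 2, by have := (hP p hp).two_le; omega⟩
      simp at h) hD
  refine hlog.not_ge (sum_log_le_of_dvd_minimalPeriod hmin hg hP fun p hp => ?_)
  refine ⟨t (e ⟨⟨p, hp⟩, ⟨0, (hP p hp).pos⟩⟩), ?_⟩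
  rw [minimalPeriod_eq_of_apply_eq_finRotate (hP p hp) (t := fun i => t (e ⟨⟨p, hp⟩, i⟩))
    (fun i => (ht _).1.trans (by simp)) (fun i => (ht _).2)]

end periods

section counting

universe u

variable {X : Type*} [Fintype X] {M : Subgroup (Equiv.Perm X)}

open scoped Classical in
theorem ncard_exists_fixed_le (M : Subgroup (Equiv.Perm X)) :
    (Set.ncard {Y : Set X | ∃ g ∈ M, g ≠ 1 ∧ (g : X → X) '' Y = Y} : ℝ) ≤
      ∑ g : M with g ≠ 1,
        2 ^ Fintype.card X * (2 : ℝ) ^ (-((movedPoints (g : Equiv.Perm X)).card : ℝ) / 2) := by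
  have hU : {Y : Set X | ∃ g ∈ M, g ≠ 1 ∧ (g : X → X) '' Y = Y} =
      ⋃ g ∈ (Finset.univ.filter fun g : M => g ≠ 1),
        {Y : Set X | ((g : Equiv.Perm X) : X → X) '' Y = Y} := by
    ext Y
    simp only [Set.mem_ofPred_eq, Set.mem_iUnion, Finset.mem_filter, Finset.mem_univ, true_and]
    constructor
    · rintro ⟨g, hg, hg1, h⟩
      exact ⟨⟨g, hg⟩, fun h' => hg1 (congrArg Subtype.val h'), h⟩
    · rintro ⟨g, hg1, h⟩
      exact ⟨g, g.2, fun h' => hg1 (Subtype.ext h'), h⟩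
  rw [hU]
  refine le_trans ?_ (Finset.sum_le_sum fun g _ => ncard_fixed_sets_le (g : Equiv.Perm X))
  exact_mod_cast Finset.set_ncard_biUnion_le _ _

open scoped Classical in
theorem sum_two_rpow_neg_movedPoints_le {κ : Type*} [Fintype κ] [Nonempty X]
    (hbase : ((Finset.univ.filter fun B : κ → X => ¬ IsBaseTuple M B).card : ℝ) ≤
      (Fintype.card X : ℝ) ^ Fintype.card κ / 3)
    (hκ : Fintype.card κ ≤ (Fintype.card X : ℝ))
    (hκ' : 24 * Fintype.card κ * Real.log (Fintype.card X) ≤ Real.log 2 * Fintype.card X) :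
    ∑ g : M, (2 : ℝ) ^ (-((movedPoints (g : Equiv.Perm X)).card : ℝ) / 4) ≤ 9 := by
  have hn1 : 1 ≤ (Fintype.card X : ℝ) := by exact_mod_cast Fintype.card_pos (α := X)
  have h := sum_pow_movedPoints_le M (q := ((Fintype.card X : ℝ) ^ 2)⁻¹) (by positivity)
    (inv_le_one_of_one_le₀ (one_le_pow₀ hn1)) hbase
  set n : ℝ := (Fintype.card X : ℝ)
  set b : ℝ := (Fintype.card κ : ℝ) with hb
  have h1 : (1 + n * (n ^ 2)⁻¹) ^ Fintype.card κ ≤ 3 := by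
    have h2 : 1 + n * (n ^ 2)⁻¹ ≤ Real.exp n⁻¹ := by
      have h3 : n * (n ^ 2)⁻¹ = n⁻¹ := by field_simp
      rw [h3, add_comm]
      exact Real.add_one_le_exp _
    refine (pow_le_pow_left₀ (by positivity) h2 _).trans ?_
    rw [← Real.exp_nat_mul]
    have h3 : (Fintype.card κ : ℝ) * n⁻¹ ≤ 1 := by
      rw [← div_eq_mul_inv]
      exact div_le_one_of_le₀ hκ (by positivity)
    exact (Real.exp_le_exp.mpr h3).trans (Real.exp_one_lt_d9.le.trans (by norm_num))
  refine le_trans (Finset.sum_le_sum fun g _ => ?_) (h.trans (by linarith))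
  set s : ℝ := ((movedPoints (g : Equiv.Perm X)).card : ℝ)
  have hs : 0 ≤ s := Nat.cast_nonneg _
  rw [Real.rpow_def_of_pos (by norm_num), Real.rpow_def_of_pos (by positivity),
    Real.exp_le_exp, Real.log_inv, Real.log_pow]
  have h4 : 3 * s * b / n * (2 * Real.log n) ≤ Real.log 2 * (s / 4) := by
    rw [div_mul_eq_mul_div, div_le_iff₀ (by positivity)]
    nlinarith
  push_cast
  linarith

open scoped Classical in
theorem exists_card_not_isBaseTuple_le {ι : Type u} [Fintype ι] [Nonempty X] {δ : ℝ} (hδ0 : 0 < δ)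
    (hδ : δ ≤ 1) (hsep : ∀ x y : X, x ≠ y → δ * (Fintype.card X : ℝ) ^ Fintype.card ι ≤
      (Finset.univ.filter fun t : ι → X => ¬ SameOrbitFixing M t x y).card) :
    ∃ (κ : Type u) (_ : Fintype κ),
      Fintype.card κ ≤ ((2 * Real.log (Fintype.card X) + 2) / δ + 1) * Fintype.card ι ∧
      ((Finset.univ.filter fun B : κ → X => ¬ IsBaseTuple M B).card : ℝ) ≤
        (Fintype.card X : ℝ) ^ Fintype.card κ / 3 := by
  have hn1 : 1 ≤ (Fintype.card X : ℝ) := by exact_mod_cast Fintype.card_pos (α := X)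
  have hlog := Real.log_nonneg hn1
  set l := ⌈(2 * Real.log (Fintype.card X) + 2) / δ⌉₊ with hl
  refine ⟨Fin l × ι, inferInstance, ?_, ?_⟩
  · rw [Fintype.card_prod, Fintype.card_fin, Nat.cast_mul]
    gcongr
    exact (Nat.ceil_lt_add_one (by positivity)).le
  have hbase := card_not_isBaseTuple_le M hδ l hsep
  refine le_trans ?_ (hbase.trans ?_)
  · refine le_of_eq ?_
    congr! 2
    ext B
    simp
  clear hbase
  set n : ℝ := (Fintype.card X : ℝ)
  have h1 : n ^ 2 * (1 - δ) ^ l ≤ 1 / 3 := by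
    have h2 : (1 - δ) ^ l ≤ Real.exp (-(2 * Real.log n + 2)) := by
      refine (pow_le_pow_left₀ (by linarith)
        (by linarith [Real.add_one_le_exp (-δ)] : 1 - δ ≤ Real.exp (-δ)) _).trans ?_
      rw [← Real.exp_nat_mul, Real.exp_le_exp]
      have h3 := Nat.le_ceil ((2 * Real.log n + 2) / δ)
      rw [div_le_iff₀ hδ0, ← hl] at h3
      linarith
    have h4 : Real.exp (2 * Real.log n) = n ^ 2 := by
      rw [mul_comm, Real.exp_mul, Real.exp_log (by positivity)]
      norm_cast
    have h5 : 3 ≤ Real.exp 2 := by linarith [Real.add_one_le_exp 2]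
    rw [Real.exp_neg, Real.exp_add, h4] at h2
    refine (mul_le_mul_of_nonneg_left h2 (by positivity)).trans ?_
    rw [mul_inv, ← mul_assoc, mul_inv_cancel₀ (by positivity), one_mul, inv_eq_one_div]
    exact one_div_le_one_div_of_le (by norm_num) h5
  have h6 : 0 ≤ n ^ Fintype.card (Fin l × ι) := by positivity
  nlinarith

open scoped Classical in
/-- The main counting bound, for a group whose minimal degree is large and for which random tuples
separate points. -/
theorem ncard_exists_fixed_le_of_separating {ι : Type*} [Fintype ι] [Nonempty X] {z : ℝ}
    (hz : z ^ 4 = Fintype.card X) (hz1 : 1 ≤ Real.log z) (hz2 : 8000 * Real.log z ^ 2 ≤ z)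
    (hι : Fintype.card ι ≤ z)
    (hsep : ∀ x y : X, x ≠ y → (4 * z ^ 2)⁻¹ * (Fintype.card X : ℝ) ^ Fintype.card ι ≤
      (Finset.univ.filter fun t : ι → X => ¬ SameOrbitFixing M t x y).card)
    (hmin : ∀ g ∈ M, g ≠ 1 → z ^ 2 / 4 ≤ (movedPoints g).card) :
    (Set.ncard {Y : Set X | ∃ g ∈ M, g ≠ 1 ∧ (g : X → X) '' Y = Y} : ℝ) ≤
      2 ^ Fintype.card X * Real.exp (-(Real.log 2 / 32) * z ^ 2) := by
  have hz3 : 8000 ≤ z := by nlinarith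
  obtain ⟨κ, _, hκ, hbase⟩ := exists_card_not_isBaseTuple_le (by positivity)
    (inv_le_one_of_one_le₀ (by nlinarith)) hsep
  have hlogn : Real.log (Fintype.card X) = 4 * Real.log z := by
    rw [← hz, Real.log_pow]; norm_num
  have hlog2 := Real.log_two_gt_d9
  have hb : (Fintype.card κ : ℝ) ≤ 41 * z ^ 3 * Real.log z := by
    rw [hlogn, div_inv_eq_mul] at hκ
    refine hκ.trans ?_
    have h1 : (2 * (4 * Real.log z) + 2) * (4 * z ^ 2) + 1 ≤ 41 * z ^ 2 * Real.log z := by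
      nlinarith [sq_nonneg z]
    calc _ ≤ 41 * z ^ 2 * Real.log z * z := by gcongr
      _ = _ := by ring
  have h24 : 24 * (Fintype.card κ : ℝ) * Real.log (Fintype.card X) ≤
      Real.log 2 * Fintype.card X := by
    rw [hlogn, ← hz]
    calc 24 * (Fintype.card κ : ℝ) * (4 * Real.log z)
        ≤ 24 * (41 * z ^ 3 * Real.log z) * (4 * Real.log z) := by gcongr
      _ = z ^ 3 * (3936 * Real.log z ^ 2) := by ring
      _ ≤ z ^ 3 * (Real.log 2 * z) := by
        refine mul_le_mul_of_nonneg_left ?_ (by positivity)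
        nlinarith
      _ = _ := by ring
  have hbn : (Fintype.card κ : ℝ) ≤ Fintype.card X := by
    have h1 : Real.log 2 ≤ 1 := by linarith [Real.log_two_lt_d9]
    have h2 : (0 : ℝ) ≤ Fintype.card κ := Nat.cast_nonneg _
    have h3 : (0 : ℝ) ≤ Fintype.card X := Nat.cast_nonneg _
    rw [hlogn] at h24
    nlinarith
  have hsum := sum_two_rpow_neg_movedPoints_le hbase hbn h24
  refine (ncard_exists_fixed_le M).trans ?_
  rw [← Finset.mul_sum]
  refine mul_le_mul_of_nonneg_left ?_ (by positivity)
  have hterm : ∀ g ∈ (Finset.univ.filter fun g : M => g ≠ 1),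
      (2 : ℝ) ^ (-((movedPoints (g : Equiv.Perm X)).card : ℝ) / 2) ≤
      (2 : ℝ) ^ (-((movedPoints (g : Equiv.Perm X)).card : ℝ) / 4) * (2 : ℝ) ^ (-z ^ 2 / 16) := by
    intro g hg
    have h1 := hmin g g.2 fun h => (Finset.mem_filter.mp hg).2 (Subtype.ext h)
    rw [← Real.rpow_add (by norm_num)]
    exact Real.rpow_le_rpow_of_exponent_le (by norm_num) (by linarith)
  refine (Finset.sum_le_sum hterm).trans ?_
  rw [← Finset.sum_mul]
  have h9 : (9 : ℝ) ≤ (2 : ℝ) ^ (z ^ 2 / 32) := by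
    calc (9 : ℝ) ≤ (2 : ℝ) ^ (4 : ℝ) := by norm_num
      _ ≤ _ := Real.rpow_le_rpow_of_exponent_le (by norm_num) (by nlinarith)
  calc _ ≤ 9 * (2 : ℝ) ^ (-z ^ 2 / 16) := by
        refine mul_le_mul_of_nonneg_right (le_trans ?_ hsum) (by positivity)
        exact Finset.sum_le_sum_of_subset_of_nonneg (Finset.filter_subset _ _)
          fun _ _ _ => by positivity
    _ ≤ (2 : ℝ) ^ (z ^ 2 / 32) * (2 : ℝ) ^ (-z ^ 2 / 16) := by gcongr
    _ = Real.exp (-(Real.log 2 / 32) * z ^ 2) := by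
        rw [← Real.rpow_add (by norm_num), Real.rpow_def_of_pos (by norm_num)]
        congr 1
        ring

end counting

section estimates

open Filter

theorem eventually_estimates : ∀ᶠ w : ℝ in atTop, 64 * Real.log w < Chebyshev.theta w ∧
    1 ≤ Real.log (w ^ 2) ∧ 8000 * Real.log (w ^ 2) ^ 2 ≤ w ^ 2 := by
  have h := (isLittleO_log_rpow_atTop (r := 1 / 2) (by norm_num)).bound
    (c := 1 / 100) (by norm_num)
  filter_upwards [h, eventually_ge_atTop 4096] with w hw hw1
  obtain ⟨s, hs0, rfl⟩ : ∃ s : ℝ, 0 ≤ s ∧ s ^ 2 = w :=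
    ⟨√w, Real.sqrt_nonneg w, Real.sq_sqrt (by linarith)⟩
  have hs : 64 ≤ s := by nlinarith
  have hlog1 : 1 ≤ Real.log (s ^ 2) := by
    rw [Real.le_log_iff_exp_le (by positivity)]
    linarith [Real.exp_one_lt_d9]
  have hlog : Real.log (s ^ 2) ≤ s / 100 := by
    rw [← Real.sqrt_eq_rpow, Real.sqrt_sq hs0, Real.norm_of_nonneg hs0,
      Real.norm_of_nonneg (by linarith)] at hw
    linarith
  have hlog2 : Real.log (s ^ 2 + 2) ≤ 2 * Real.log (s ^ 2) := by
    rw [← Real.log_rpow (by positivity)]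
    refine Real.log_le_log (by positivity) ?_
    norm_cast
    nlinarith
  refine ⟨?_, ?_, ?_⟩
  · have h1 := Chebyshev.theta_ge' (x := s ^ 2) (by linarith)
    rw [Real.sqrt_sq hs0] at h1
    have h2 := Real.log_two_gt_d9
    nlinarith
  · rw [Real.log_pow]
    push_cast
    linarith
  · have h4 : Real.log ((s ^ 2) ^ 2) = 2 * Real.log (s ^ 2) := by
      rw [Real.log_pow]
      norm_num
    rw [h4]
    have h3 : Real.log (s ^ 2) ^ 2 ≤ (s / 100) ^ 2 := pow_le_pow_left₀ (by linarith) hlog 2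
    nlinarith

end estimates

section transitivity

variable {X : Type*} [Fintype X] {M : Subgroup (Equiv.Perm X)}

theorem distinguishing_apply_subset_movedPoints {g : Equiv.Perm X} (hg : g ∈ M) (x : X) :
    distinguishing M x (g x) ⊆ movedPoints g := by
  intro z hz
  rw [mem_distinguishing] at hz
  rw [mem_movedPoints]
  intro h
  refine hz ⟨g, hg, rfl, h⟩

open scoped Classical in
theorem card_not_sameOrbitFixing_of_unique {ι : Type*} [Fintype ι] [Unique ι] (x y : X) :
    (Finset.univ.filter fun t : ι → X => ¬ SameOrbitFixing M t x y).card =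
      (distinguishing M x y).card := by
  refine Finset.card_equiv (Equiv.funUnique ι X) fun t => ?_
  simp only [Finset.mem_filter, Finset.mem_univ, true_and, mem_distinguishing]
  refine not_congr ⟨?_, ?_⟩
  · rintro ⟨g, hg, h, h'⟩
    exact ⟨g, hg, h', h default⟩
  · rintro ⟨g, hg, h', h⟩
    exact ⟨g, hg, fun i => by rw [Unique.eq_default i]; exact h, h'⟩

open scoped Classical in
theorem ncard_exists_fixed_le_of_not_twoTransitive [Nonempty X] (hM : IsPrimitiveSubgroup M)
    (h2 : ¬ ∀ a b c d : X, a ≠ b → c ≠ d → SameOrbital M a b c d) {z : ℝ}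
    (hz : z ^ 4 = Fintype.card X) (hz1 : 1 ≤ Real.log z) (hz2 : 8000 * Real.log z ^ 2 ≤ z) :
    (Set.ncard {Y : Set X | ∃ g ∈ M, g ≠ 1 ∧ (g : X → X) '' Y = Y} : ℝ) ≤
      2 ^ Fintype.card X * Real.exp (-(Real.log 2 / 32) * z ^ 2) := by
  have hz3 : 8000 ≤ z := by nlinarith
  have hdist : ∀ x y : X, x ≠ y → z ^ 2 / 4 ≤ (distinguishing M x y).card := by
    intro x y hxy
    have h := card_le_mul_card_distinguishing_sq hM h2 hxy
    have h' : (Fintype.card X : ℝ) ≤ 16 * (distinguishing M x y).card ^ 2 := by exact_mod_cast h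
    rw [← hz] at h'
    refine le_of_sq_le_sq ?_ (Nat.cast_nonneg _)
    linarith
  refine ncard_exists_fixed_le_of_separating (ι := Unit) hz hz1 hz2 ?_ (fun x y hxy => ?_)
    fun g hg hg1 => ?_
  · simp only [Fintype.card_unit, Nat.cast_one]
    linarith
  · rw [card_not_sameOrbitFixing_of_unique, ← hz, Fintype.card_unit, pow_one]
    refine le_trans (le_of_eq ?_) (hdist x y hxy)
    field_simp
  · obtain ⟨x, hx⟩ := movedPoints_nonempty hg1
    refine (hdist x (g x) (mem_movedPoints.mp hx).symm).trans ?_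
    exact_mod_cast Finset.card_le_card (distinguishing_apply_subset_movedPoints hg x)

theorem sum_primesLE_le (n : ℕ) : ∑ p ∈ n.primesLE, p ≤ n ^ 2 := by
  have hsub : n.primesLE ⊆ Finset.Icc 1 n := fun p hp => by
    rw [Nat.mem_primesLE] at hp
    exact Finset.mem_Icc.mpr ⟨hp.2.one_le, hp.1⟩
  calc ∑ p ∈ n.primesLE, p ≤ n.primesLE.card * n :=
        Finset.sum_le_card_nsmul _ _ _ fun p hp => (Finset.mem_Icc.mp (hsub hp)).2
    _ ≤ n * n := Nat.mul_le_mul_right _ (by simpa using Finset.card_le_card hsub)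
    _ = n ^ 2 := (sq n).symm

open scoped Classical in
theorem ncard_exists_fixed_le_of_twoTransitive [Nonempty X] (hM : IsPrimitiveSubgroup M)
    (h2 : ∀ a b c d : X, a ≠ b → c ≠ d → SameOrbital M a b c d)
    (hA : ¬ alternatingGroup X ≤ M) {w : ℝ} (hw0 : 0 < w) (hw : w ^ 8 = Fintype.card X)
    (hθ : 64 * Real.log w < Chebyshev.theta w)
    (hw1 : 1 ≤ Real.log (w ^ 2)) (hw2 : 8000 * Real.log (w ^ 2) ^ 2 ≤ w ^ 2) :
    (Set.ncard {Y : Set X | ∃ g ∈ M, g ≠ 1 ∧ (g : X → X) '' Y = Y} : ℝ) ≤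
      2 ^ Fintype.card X * Real.exp (-(Real.log 2 / 32) * (w ^ 2) ^ 2) := by
  set z := w ^ 2 with hzw
  have hz : z ^ 4 = Fintype.card X := by rw [← hw, hzw]; ring
  have hz3 : 8000 ≤ z := by nlinarith
  have hmin : ∀ g ∈ M, g ≠ 1 → Fintype.card X ≤ 8 * (movedPoints g).card :=
    fun g hg hg1 => (card_lt_mul_card_movedPoints hM h2 hA hg hg1).le
  have hι : (Fintype.card (Σ p : (⌊w⌋₊).primesLE, Fin p) : ℝ) ≤ z := by
    rw [Fintype.card_sigma]
    simp only [Fintype.card_fin]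
    rw [Finset.sum_coe_sort _ fun p => p]
    refine le_trans (Nat.cast_le.mpr (sum_primesLE_le _)) ?_
    push_cast
    exact pow_le_pow_left₀ (Nat.cast_nonneg _) (Nat.floor_le hw0.le) 2
  refine ncard_exists_fixed_le_of_separating hz hw1 hw2 hι (fun x y hxy => ?_)
    fun g hg hg1 => ?_
  · have hfloor := Nat.floor_le (a := (4 * z ^ 2)⁻¹ *
      (Fintype.card X : ℝ) ^ Fintype.card (Σ p : (⌊w⌋₊).primesLE, Fin p)) (by positivity)
    have hlt := Nat.lt_floor_add_one ((4 * z ^ 2)⁻¹ *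
      (Fintype.card X : ℝ) ^ Fintype.card (Σ p : (⌊w⌋₊).primesLE, Fin p))
    refine hlt.le.trans ?_
    have hcount := lt_card_not_sameOrbitFixing h2 hmin
      (P := (⌊w⌋₊).primesLE) (fun p hp => (Nat.mem_primesLE.mp hp).2) (Equiv.refl _)
      (D := ⌊(4 * z ^ 2)⁻¹ *
        (Fintype.card X : ℝ) ^ Fintype.card (Σ p : (⌊w⌋₊).primesLE, Fin p)⌋₊) ?_ ?_ hxy
    · exact_mod_cast hcount
    · rw [← Chebyshev.theta_eq_sum_primesLE, ← hw, Real.log_pow]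
      push_cast
      linarith
    · generalize Fintype.card (Σ p : (⌊w⌋₊).primesLE, Fin p) = k at *
      generalize hD : ⌊(4 * z ^ 2)⁻¹ * (Fintype.card X : ℝ) ^ k⌋₊ = D at *
      have hpos : 0 < (Fintype.card X : ℝ) ^ k := by
        have : (0 : ℝ) < Fintype.card X := by rw [← hz]; positivity
        positivity
      rw [← Nat.cast_lt (α := ℝ)]
      push_cast
      rw [inv_mul_eq_div, le_div_iff₀ (by positivity)] at hfloor
      generalize (Fintype.card X : ℝ) ^ k = N at *
      rw [← hz]
      have h1 : 2 * (k : ℝ) * D * z ^ 4 ≤ z ^ 3 * N := by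
        calc 2 * (k : ℝ) * D * z ^ 4 ≤ 2 * z * D * z ^ 4 := by gcongr
          _ = z ^ 3 / 2 * (D * (4 * z ^ 2)) := by ring
          _ ≤ z ^ 3 / 2 * N := by gcongr
          _ ≤ z ^ 3 * N := by gcongr; linarith [pow_pos (show 0 < z by linarith) 3]
      have h3 : z ^ 3 + z < z ^ 4 := by nlinarith [pow_pos (show 0 < z by linarith) 3]
      calc 2 * (k : ℝ) * D * z ^ 4 + k * N ≤ z ^ 3 * N + z * N := by gcongr
        _ = (z ^ 3 + z) * N := by ring
        _ < z ^ 4 * N := by gcongr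
  · have h : (Fintype.card X : ℝ) ≤ 8 * (movedPoints g).card := by exact_mod_cast hmin g hg hg1
    rw [← hz] at h
    have h1 : 2 ≤ z ^ 2 := by nlinarith
    nlinarith

end transitivity

theorem probability_of_rigidity :
    ∃ c : ℝ, 0 < c ∧ ∃ n₀ : ℕ, ∀ (X : Type) [Fintype X] [DecidableEq X],
      n₀ ≤ Fintype.card X →
      ∀ M : Subgroup (Equiv.Perm X), IsPrimitiveSubgroup M → IsMaximalSubgroup M →
        (Set.ncard {Y : Set X | ∃ g ∈ M, g ≠ 1 ∧ (g : X → X) '' Y = Y} : ℝ) ≤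
          2 ^ (Fintype.card X) * Real.exp (-c * Real.sqrt (Fintype.card X)) := by
  obtain ⟨n₀, hn₀⟩ := Filter.eventually_atTop.mp ((tendsto_rpow_atTop
    (y := 1 / 8) (by norm_num)).eventually eventually_estimates)
  refine ⟨Real.log 2 / 32, by positivity, max ⌈n₀⌉₊ 1, fun X _ _ hn M hM hmax => ?_⟩
  obtain rfl : ‹DecidableEq X› = fun a b => Classical.propDecidable (a = b) :=
    Subsingleton.elim _ _
  have hpos : 0 < Fintype.card X := (le_max_right _ _).trans hn
  have : Nonempty X := Fintype.card_pos_iff.mp hpos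
  obtain ⟨hθ, hw1, hw2⟩ := hn₀ (Fintype.card X)
    ((Nat.le_ceil _).trans (Nat.cast_le.mpr ((le_max_left _ _).trans hn)))
  have hw : ((Fintype.card X : ℝ) ^ (1 / 8 : ℝ)) ^ 8 = Fintype.card X := by
    rw [← Real.rpow_natCast, ← Real.rpow_mul (Nat.cast_nonneg _)]
    norm_num
  have hw0 : 0 < (Fintype.card X : ℝ) ^ (1 / 8 : ℝ) := by positivity
  generalize (Fintype.card X : ℝ) ^ (1 / 8 : ℝ) = w at *
  have hsqrt : √(Fintype.card X : ℝ) = (w ^ 2) ^ 2 := by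
    rw [← hw, show w ^ 8 = ((w ^ 2) ^ 2) ^ 2 by ring, Real.sqrt_sq (by positivity)]
  rw [hsqrt]
  by_cases h2 : ∀ a b c d : X, a ≠ b → c ≠ d → SameOrbital M a b c d
  · classical
    exact ncard_exists_fixed_le_of_twoTransitive hM h2
      (not_alternatingGroup_le_of_isMaximalSubgroup hmax) hw0 hw hθ hw1 hw2
  · exact ncard_exists_fixed_le_of_not_twoTransitive hM h2 (by rw [← hw]; ring) hw1 hw2
end

section
/- Let X be a finite set, let g ∈ Sym(X), and let c be the number of orbits of the cyclic group ⟨g⟩ on X. Then for every natural number k, the number of k-element subsets Y ⊆ X with g(Y) = Y is at most ∑_{i=0}^{k} C(c, i), where C denotes the binomial coefficient. -/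
open scoped Pointwise in
theorem Equiv.Perm.mem_of_orbitRel_zpowers {X : Type*} {g : Equiv.Perm X} {Y : Set X}
    (hY : (g : X → X) '' Y = Y) {x y : X}
    (h : (MulAction.orbitRel (Subgroup.zpowers g) X) x y) (hy : y ∈ Y) : x ∈ Y := by
  obtain ⟨⟨σ, hσ⟩, rfl⟩ := h
  have hg : g ∈ MulAction.stabilizer (Equiv.Perm X) Y := hY
  have hσY : σ • Y = Y := (Subgroup.zpowers_le.mpr hg) hσ
  rw [← hσY]
  exact Set.smul_mem_smul_set hy

theorem fixed_k_subsets_bound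
    (X : Type) [Fintype X] (g : Equiv.Perm X)
    (c : ℕ) (hc : c = Nat.card (MulAction.orbitRel.Quotient (Subgroup.zpowers g) X))
    (k : ℕ) :
    Set.ncard {Y : Set X | Y.ncard = k ∧ (g : X → X) '' Y = Y} ≤
      ∑ i ∈ Finset.range (k + 1), Nat.choose c i := by
  classical
  let Q := MulAction.orbitRel.Quotient (Subgroup.zpowers g) X
  let π : X → Q := Quotient.mk _
  have : Fintype Q := Fintype.ofSurjective π Quotient.mk_surjective
  let T : Finset (Finset Q) :=
    (Finset.range (k + 1)).biUnion fun i => Finset.powersetCard i Finset.univ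
  have hT : T.card ≤ ∑ i ∈ Finset.range (k + 1), Nat.choose c i := by
    refine Finset.card_biUnion_le.trans (Finset.sum_le_sum fun i _ => ?_)
    rw [Finset.card_powersetCard, Finset.card_univ, hc, Nat.card_eq_fintype_card]
  refine le_trans ?_ hT
  rw [← Set.ncard_coe_finset T]
  refine Set.ncard_le_ncard_of_injOn (fun Y => (π '' Y).toFinset) ?_ ?_
  · rintro Y ⟨hk, -⟩
    have hle : (π '' Y).toFinset.card ≤ k := by
      rw [← Set.ncard_eq_toFinset_card', ← hk]
      exact Set.ncard_image_le
    simpa [T] using Nat.lt_succ_of_le hle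
  · rintro Y ⟨-, hY⟩ Z ⟨-, hZ⟩ hYZ
    have himage : π '' Y = π '' Z := Set.toFinset_inj.mp hYZ
    have hsub : ∀ {A B : Set X}, (g : X → X) '' B = B → π '' A = π '' B → A ⊆ B := by
      intro A B hB hAB x hx
      obtain ⟨y, hy, hyx⟩ : π x ∈ π '' B := hAB ▸ Set.mem_image_of_mem π hx
      exact Equiv.Perm.mem_of_orbitRel_zpowers hB (Quotient.exact hyx.symm) hy
    exact (hsub hZ himage).antisymm (hsub hY himage.symm)
end

section
/- There exist a constant c₁ > 0 and a natural number n₀ such that the following holds. Let X be a finite set with n := |X| ≥ n₀ and let t be a natural number with 3 ≤ t and 2·t ≤ n. Then the number of t-uniform hypergraphs on X, i.e., families ℋ of t-element subsets of X, that admit a non-identity automorphism (a σ ∈ Sym(X), σ ≠ id, with {σ(E) : E ∈ ℋ} = ℋ) is at most 2^(C(n,t)) · exp(−c₁·C(n−1, t−1)), where C denotes the binomial coefficient. -/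
theorem choose_le_ncard_mem_notMem {X : Type*} [Fintype X] {x y : X} (hxy : x ≠ y) {t : ℕ}
    (ht : 1 ≤ t) :
    (Fintype.card X - 2).choose (t - 1) ≤ {E : Set X | E.ncard = t ∧ x ∈ E ∧ y ∉ E}.ncard := by
  classical
  have hcard : (({x, y}ᶜ : Finset X).powersetCard (t - 1)).card =
      (Fintype.card X - 2).choose (t - 1) := by
    rw [Finset.card_powersetCard, Finset.card_compl, Finset.card_pair hxy]
  rw [← hcard, ← Set.ncard_coe_finset]
  refine Set.ncard_le_ncard_of_injOn (fun s : Finset X => ((insert x s : Finset X) : Set X))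
    ?_ ?_ (Set.toFinite _)
  · intro s hs
    obtain ⟨hsub, hs⟩ := Finset.mem_powersetCard.1 (Finset.mem_coe.1 hs)
    have hx : x ∉ s := fun h => by simpa using hsub h
    have hy : y ∉ s := fun h => by simpa using hsub h
    refine ⟨?_, by simp, by simp [hy, hxy.symm]⟩
    rw [Set.ncard_coe_finset, Finset.card_insert_of_notMem hx, hs]
    omega
  · intro s hs r hr h
    have hxs : x ∉ s := fun h =>
      by simpa using (Finset.mem_powersetCard.1 (Finset.mem_coe.1 hs)).1 h
    have hxr : x ∉ r := fun h =>
      by simpa using (Finset.mem_powersetCard.1 (Finset.mem_coe.1 hr)).1 h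
    have h' : insert x s = insert x r := Finset.coe_injective h
    rw [← Finset.erase_insert hxs, h', Finset.erase_insert hxr]

theorem ncard_setOf_ncard_eq_le (X : Type*) [Fintype X] (t : ℕ) :
    {E : Set X | E.ncard = t}.ncard ≤ (Fintype.card X).choose t := by
  classical
  have hcard : ((Finset.univ : Finset X).powersetCard t).card = (Fintype.card X).choose t := by
    rw [Finset.card_powersetCard, Finset.card_univ]
  rw [← hcard, ← Set.ncard_coe_finset]
  refine Set.ncard_le_ncard_of_injOn (fun E : Set X => E.toFinset) ?_ ?_ (Set.toFinite _)
  · intro E hE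
    have hE : E.ncard = t := hE
    simp [Finset.mem_powersetCard, ← hE, Set.ncard_eq_toFinset_card']
  · intro E _ F _ h
    exact Set.toFinset_inj.1 h

/-- A hypergraph invariant under `σ` is determined by its edges outside the sets that contain `x`
but not `σ x`. -/
theorem ncard_invariant_hypergraphs_le {X : Type*} [Fintype X] {σ : Equiv.Perm X} (hσ : σ ≠ 1)
    {t : ℕ} (ht : 1 ≤ t) :
    {ℋ : Set (Set X) | (∀ E ∈ ℋ, E.ncard = t) ∧
        (fun E : Set X => (σ : X → X) '' E) '' ℋ = ℋ}.ncard ≤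
      2 ^ ((Fintype.card X).choose t - (Fintype.card X - 2).choose (t - 1)) := by
  classical
  obtain ⟨x, hx⟩ : ∃ x, σ x ≠ x := by
    by_contra! h
    exact hσ (Equiv.ext h)
  set T : Set (Set X) := {E | E.ncard = t} with hT
  set A : Set (Set X) := {E | E.ncard = t ∧ x ∈ E ∧ σ x ∉ E} with hA
  have hAT : A ⊆ T := fun E hE => hE.1
  have hdiff : (T \ A).ncard ≤
      (Fintype.card X).choose t - (Fintype.card X - 2).choose (t - 1) := by
    rw [Set.ncard_sdiff hAT (Set.toFinite _)]
    exact tsub_le_tsub (ncard_setOf_ncard_eq_le X t) (choose_le_ncard_mem_notMem hx.symm ht)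
  refine le_trans ?_ (Nat.pow_le_pow_right two_pos hdiff)
  rw [← Set.ncard_powerset _ (Set.toFinite _)]
  have hmem : ∀ ℋ : Set (Set X), (fun E : Set X => (σ : X → X) '' E) '' ℋ = ℋ →
      ∀ E, E ∈ ℋ ↔ (σ : X → X) '' E ∈ ℋ := by
    intro ℋ h E
    conv_rhs => rw [← h]
    exact (σ.injective.image_injective.mem_set_image (s := ℋ) (a := E)).symm
  refine Set.ncard_le_ncard_of_injOn (fun ℋ => ℋ \ A) ?_ ?_ (Set.toFinite _)
  · rintro ℋ ⟨h, -⟩ E ⟨hE, hEA⟩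
    exact ⟨h E hE, hEA⟩
  · rintro ℋ ⟨-, hℋ⟩ 𝒢 ⟨-, h𝒢⟩ h
    have hout : ∀ E, E ∉ A → (E ∈ ℋ ↔ E ∈ 𝒢) := fun E hE => by
      simpa [hE] using Set.ext_iff.1 h E
    ext E
    by_cases hE : E ∈ A
    · rw [hmem ℋ hℋ, hmem 𝒢 h𝒢]
      refine hout _ fun hσE => hσE.2.2 ⟨x, hE.2.1, rfl⟩
    · exact hout E hE

theorem ncard_symmetric_hypergraphs_le (X : Type*) [Fintype X] {t : ℕ} (ht : 1 ≤ t) :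
    {ℋ : Set (Set X) | (∀ E ∈ ℋ, E.ncard = t) ∧
        ∃ σ : Equiv.Perm X, σ ≠ 1 ∧ (fun E : Set X => (σ : X → X) '' E) '' ℋ = ℋ}.ncard ≤
      (Fintype.card X).factorial *
        2 ^ ((Fintype.card X).choose t - (Fintype.card X - 2).choose (t - 1)) := by
  classical
  let S : Equiv.Perm X → Set (Set (Set X)) := fun σ =>
    {ℋ | (∀ E ∈ ℋ, E.ncard = t) ∧ (fun E : Set X => (σ : X → X) '' E) '' ℋ = ℋ}
  let P : Finset (Equiv.Perm X) := Finset.univ.filter (· ≠ 1)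
  calc
    _ ≤ ((P.biUnion fun σ => (S σ).toFinset : Finset (Set (Set X))) : Set (Set (Set X))).ncard := by
        refine Set.ncard_le_ncard ?_ (Set.toFinite _)
        rintro ℋ ⟨h, σ, hσ, hℋ⟩
        simp only [Finset.mem_coe, Finset.mem_biUnion, Set.mem_toFinset]
        exact ⟨σ, by simpa [P] using hσ, h, hℋ⟩
    _ ≤ P.card * 2 ^ ((Fintype.card X).choose t - (Fintype.card X - 2).choose (t - 1)) := by
        rw [Set.ncard_coe_finset]
        refine Finset.card_biUnion_le_card_mul _ _ _ fun σ hσ => ?_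
        rw [← Set.ncard_eq_toFinset_card']
        exact ncard_invariant_hypergraphs_le (by simpa [P] using hσ) ht
    _ ≤ _ := by
        gcongr
        rw [← Fintype.card_perm]
        exact Finset.card_le_univ _

theorem choose_pred_le_two_mul_choose {n t : ℕ} (ht : 1 ≤ t) (htn : 2 * t ≤ n) :
    (n - 1).choose (t - 1) ≤ 2 * (n - 2).choose (t - 1) := by
  obtain ⟨m, rfl⟩ : ∃ m, n = m + 2 := ⟨n - 2, by omega⟩
  obtain ⟨s, rfl⟩ : ∃ s, t = s + 1 := ⟨t - 1, by omega⟩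
  have h := Nat.choose_mul_succ_eq m s
  simp only [Nat.add_sub_cancel, show m + 2 - 1 = m + 1 by omega]
  have h2 : m + 1 ≤ 2 * (m + 1 - s) := by omega
  have hpos : 0 < m + 1 := by omega
  nlinarith [Nat.mul_le_mul_left ((m + 1).choose s) h2]

theorem choose_two_le_choose {n k : ℕ} (hk : 2 ≤ k) (hkn : 2 * k ≤ n) :
    n.choose 2 ≤ n.choose k := by
  induction k, hk using Nat.le_induction with
  | base => exact le_rfl
  | succ k hk ih =>
    exact (ih (by omega)).trans (Nat.choose_le_succ_of_lt_half_left (by omega))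

theorem eventually_log_le_div_hundred :
    ∃ n₀ : ℕ, ∀ n : ℕ, n₀ ≤ n → Real.log n ≤ n / 100 := by
  have h := (Real.isLittleO_log_id_atTop.comp_tendsto tendsto_natCast_atTop_atTop).def
    (show (0 : ℝ) < 1 / 100 by norm_num)
  obtain ⟨n₀, hn₀⟩ := Filter.eventually_atTop.1 h
  refine ⟨n₀, fun n hn => ?_⟩
  have := hn₀ n hn
  simp only [Function.comp_apply, id, Real.norm_eq_abs, Nat.abs_cast] at this
  linarith [le_abs_self (Real.log n)]

theorem random_t_uniform_hypergraph_asymmetric :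
    ∃ c₁ : ℝ, 0 < c₁ ∧ ∃ n₀ : ℕ, ∀ (X : Type) [Fintype X],
      n₀ ≤ Fintype.card X →
      ∀ t : ℕ, 3 ≤ t → 2 * t ≤ Fintype.card X →
        (Set.ncard {ℋ : Set (Set X) | (∀ E ∈ ℋ, E.ncard = t) ∧
            ∃ σ : Equiv.Perm X, σ ≠ 1 ∧
              (fun E : Set X => (σ : X → X) '' E) '' ℋ = ℋ} : ℝ) ≤
          2 ^ (Nat.choose (Fintype.card X) t) *
            Real.exp (-c₁ * (Nat.choose (Fintype.card X - 1) (t - 1) : ℝ)) := by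
  obtain ⟨n₀, hn₀⟩ := eventually_log_le_div_hundred
  refine ⟨1 / 10, by norm_num, max n₀ 10, fun X _ hX t ht htn => ?_⟩
  have hcount := ncard_symmetric_hypergraphs_le X (t := t) (by omega)
  have hlog := hn₀ _ ((le_max_left _ _).trans hX)
  have hn10 : 10 ≤ Fintype.card X := (le_max_right _ _).trans hX
  generalize Fintype.card X = n at *
  have hhalf : ((n - 1).choose (t - 1) : ℝ) ≤ 2 * ((n - 2).choose (t - 1) : ℝ) := by
    exact_mod_cast choose_pred_le_two_mul_choose (by omega) htn
  have hle : (n - 2).choose (t - 1) ≤ n.choose t := by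
    obtain ⟨s, rfl⟩ : ∃ s, t = s + 1 := ⟨t - 1, by omega⟩
    obtain ⟨m, rfl⟩ : ∃ m, n = m + 1 := ⟨n - 1, by omega⟩
    rw [Nat.choose_succ_succ]
    exact (Nat.choose_le_choose s (by omega)).trans (Nat.le_add_right _ _)
  have hquad : ((n : ℝ) - 1) * (n - 2) / 2 ≤ ((n - 1).choose (t - 1) : ℝ) := by
    have h : (((n - 1).choose 2 : ℕ) : ℝ) ≤ ((n - 1).choose (t - 1) : ℝ) := by
      exact_mod_cast choose_two_le_choose (by omega) (by omega)
    rw [Nat.cast_choose_two, Nat.cast_sub (by omega)] at h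
    push_cast at h
    linarith
  have hfact : (n.factorial : ℝ) ≤ Real.exp (n * Real.log n) := by
    rw [mul_comm, Real.exp_mul, Real.exp_log (by positivity), Real.rpow_natCast]
    exact_mod_cast Nat.factorial_le_pow n
  have hpow : (2 : ℝ) ^ (n.choose t - (n - 2).choose (t - 1)) =
      2 ^ n.choose t * Real.exp (-(Real.log 2 * (n - 2).choose (t - 1))) := by
    rw [pow_sub₀ _ two_ne_zero hle, Real.exp_neg, Real.exp_mul, Real.exp_log two_pos,
      Real.rpow_natCast]
  have hnR : (10 : ℝ) ≤ n := by exact_mod_cast hn10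
  have hlog2 := Real.log_two_gt_d9
  calc
    _ ≤ (n.factorial : ℝ) * 2 ^ (n.choose t - (n - 2).choose (t - 1)) := by exact_mod_cast hcount
    _ ≤ Real.exp (n * Real.log n) *
        (2 ^ n.choose t * Real.exp (-(Real.log 2 * (n - 2).choose (t - 1)))) := by
      rw [hpow]
      gcongr
    _ = 2 ^ n.choose t *
        Real.exp (n * Real.log n - Real.log 2 * (n - 2).choose (t - 1)) := by
      rw [sub_eq_add_neg, Real.exp_add]
      ring
    _ ≤ _ := by
      gcongr
      have h1 : (n : ℝ) * Real.log n ≤ n * (n / 100) := by gcongr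
      have h2 : (3 / 5 : ℝ) * (n - 2).choose (t - 1) ≤ Real.log 2 * (n - 2).choose (t - 1) := by
        gcongr
        linarith
      nlinarith
end

section
/- There exist a constant c > 0 and a natural number n₀ such that the following holds. Let t ≥ 3 and r ≥ 2 be natural numbers with n := t·r ≥ n₀ and 2·t ≤ n. A balanced t-partite transversal hypergraph is a set ℋ of functions f : Fin t → Fin r (each f identified with the transversal edge {(i, f(i)) : i ∈ Fin t} in the vertex set Fin t × Fin r partitioned into the layers {i} × Fin r). A pair (τ, π) with τ ∈ Sym(Fin t) and π : Fin t → Sym(Fin r) acts on such an ℋ by sending f to the function j ↦ π(τ⁻¹(j))(f(τ⁻¹(j))); the pair is an automorphism of ℋ if this action maps ℋ onto itself, and it is non-identity if the induced permutation (i,x) ↦ (τ(i), π(i)(x)) of Fin t × Fin r is not the identity. Then the number of sets ℋ of functions Fin t → Fin r admitting a non-identity automorphism pair is at most 2^(r^t) · 2^(−c·n²). -/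
/-- If a set `T` is disjoint from its image under `φ`, then a `φ`-invariant set is determined by
its part outside `T`. -/
theorem ncard_setOf_image_eq_mul_two_pow_le {α : Type*} [Fintype α] (φ : α → α)
    (hφ : Function.Injective φ) (T : Finset α) (hT : ∀ x ∈ T, φ x ∉ T) :
    {S : Set α | φ '' S = S}.ncard * 2 ^ T.card ≤ 2 ^ Fintype.card α := by
  classical
  have hle : {S : Set α | φ '' S = S}.ncard ≤ (𝒫 ((Tᶜ : Finset α) : Set α)).ncard := by
    refine Set.ncard_le_ncard_of_injOn (fun S => S ∩ ((Tᶜ : Finset α) : Set α))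
      (fun S _ => Set.inter_subset_right) ?_ (Set.toFinite _)
    intro S hS S' hS' h
    have mem_iff : ∀ {R : Set α}, φ '' R = R → ∀ x, x ∈ R ↔ φ x ∈ R := fun {R} hR x => by
      conv_rhs => rw [← hR]
      exact (hφ.mem_set_image).symm
    have off : ∀ x ∉ T, (x ∈ S ↔ x ∈ S') := fun x hx => by
      have := Set.ext_iff.1 h x
      simpa [hx] using this
    ext x
    by_cases hx : x ∈ T
    · rw [mem_iff hS, mem_iff hS', off _ (hT x hx)]
    · exact off x hx
  rw [Set.ncard_powerset _ (Set.toFinite _), Set.ncard_coe_finset] at hle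
  calc _ ≤ 2 ^ (Tᶜ).card * 2 ^ T.card := Nat.mul_le_mul_right _ hle
    _ = _ := by rw [← pow_add, Finset.card_compl_add_card]

theorem card_filter_apply_eq {t r : ℕ} (i : Fin t) (a : Fin r) :
    (Finset.univ.filter fun f : Fin t → Fin r => f i = a).card = r ^ (t - 1) := by
  simpa using Fintype.card_filter_piFinset_const_eq_of_mem Finset.univ i (Finset.mem_univ a)

theorem pow_le_two_mul_card_filter {t r : ℕ} (hr : 2 ≤ r) (i j : Fin t) (a b : Fin r)
    (h : i = j → a ≠ b) :
    r ^ (t - 1) ≤ 2 * (Finset.univ.filter fun f : Fin t → Fin r => f i = a ∧ f j ≠ b).card := by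
  classical
  rw [← card_filter_apply_eq i a,
    ← Finset.card_filter_add_card_filter_not (s := Finset.univ.filter fun f => f i = a)
      (fun f : Fin t → Fin r => f j = b), Finset.filter_filter, Finset.filter_filter, two_mul]
  refine Nat.add_le_add_right ?_ _
  obtain ⟨c, hc⟩ : ∃ c : Fin r, c ≠ b :=
    haveI : Nontrivial (Fin r) := Fin.nontrivial_iff_two_le.2 hr
    exists_ne b
  refine Finset.card_le_card_of_injOn (fun f => Function.update f j c) ?_ ?_
  · intro f hf
    simp only [Finset.coe_filter, Finset.mem_univ, true_and, Set.mem_ofPred_eq] at hf ⊢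
    have hij : i ≠ j := fun hij => h hij (by rw [← hf.1, ← hf.2, hij])
    simp [hij, hf.1, hc]
  · intro f hf g hg hfg
    simp only [Finset.coe_filter, Finset.mem_univ, true_and, Set.mem_ofPred_eq] at hf hg
    ext k
    by_cases hk : k = j
    · rw [hk, hf.2, hg.2]
    · simpa [hk] using congrArg Fin.val (congrFun hfg k)

theorem sq_le_nine_mul_two_pow (k : ℕ) : (k + 3) ^ 2 ≤ 9 * 2 ^ k := by
  induction k with
  | zero => norm_num
  | succ k ih =>
    calc (k + 1 + 3) ^ 2 ≤ (k + 3) ^ 2 * 2 := by ring_nf; omega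
      _ ≤ 9 * 2 ^ k * 2 := Nat.mul_le_mul_right _ ih
      _ = 9 * 2 ^ (k + 1) := by ring

theorem sq_mul_le_nine_mul_pow {t r : ℕ} (ht : 3 ≤ t) (hr : 2 ≤ r) :
    (t * r) ^ 2 ≤ 9 * r ^ (t - 1) := by
  obtain ⟨k, rfl⟩ := Nat.exists_eq_add_of_le' ht
  calc ((k + 3) * r) ^ 2 = (k + 3) ^ 2 * r ^ 2 := mul_pow ..
    _ ≤ 9 * 2 ^ k * r ^ 2 := Nat.mul_le_mul_right _ (sq_le_nine_mul_two_pow k)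
    _ ≤ 9 * r ^ k * r ^ 2 := by gcongr
    _ = 9 * r ^ (k + 3 - 1) := by rw [mul_assoc, ← pow_add]; rfl

theorem factorial_mul_factorial_pow_le {t r : ℕ} (hr : 1 ≤ r) :
    t.factorial * r.factorial ^ t ≤ (t * r) ^ (t * r) := by
  rcases Nat.eq_zero_or_pos t with rfl | ht
  · simp
  calc t.factorial * r.factorial ^ t ≤ t ^ (t * r) * (r ^ r) ^ t := by
        gcongr
        · exact (Nat.factorial_le_pow t).trans
            (Nat.pow_le_pow_right ht (Nat.le_mul_of_pos_right t hr))
        · exact Nat.factorial_le_pow r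
    _ = (t * r) ^ (t * r) := by rw [mul_pow, ← pow_mul, mul_comm r t]

/-- The number of sets of functions `Fin t → Fin r` invariant under a fixed non-identity pair. -/
theorem ncard_fixed_le {t r : ℕ} (ht : 3 ≤ t) (hr : 2 ≤ r) (τ : Equiv.Perm (Fin t))
    (π : Fin t → Equiv.Perm (Fin r)) (h : ¬ ∀ (i : Fin t) (x : Fin r), τ i = i ∧ π i x = x) :
    ({ℋ : Set (Fin t → Fin r) |
        (fun f : Fin t → Fin r => fun j => π (τ⁻¹ j) (f (τ⁻¹ j))) '' ℋ = ℋ}.ncard : ℝ) ≤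
      2 ^ (r ^ t) * (2 : ℝ) ^ (-(1 / 18) * ((t * r : ℕ) : ℝ) ^ 2) := by
  classical
  simp only [not_forall] at h
  obtain ⟨i, a, hia⟩ := h
  set T := Finset.univ.filter fun f : Fin t → Fin r => f i = a ∧ f (τ i) ≠ π i a with hTdef
  have hT : r ^ (t - 1) ≤ 2 * T.card :=
    pow_le_two_mul_card_filter hr i (τ i) a (π i a)
      fun h₁ h₂ => hia ⟨h₁.symm, h₂.symm⟩
  have hinj : Function.Injective
      (fun f : Fin t → Fin r => fun j => π (τ⁻¹ j) (f (τ⁻¹ j))) := by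
    intro f g hfg
    funext k
    simpa using congrFun hfg (τ k)
  have hcount := ncard_setOf_image_eq_mul_two_pow_le _ hinj T (by
    intro f hf
    simp only [hTdef, Finset.mem_filter, Finset.mem_univ, true_and] at hf ⊢
    simp [hf.1])
  rw [Fintype.card_fun, Fintype.card_fin, Fintype.card_fin] at hcount
  have hsize : ((t * r : ℕ) : ℝ) ^ 2 ≤ 18 * T.card := by
    exact_mod_cast (show (t * r) ^ 2 ≤ 18 * T.card by
      have := sq_mul_le_nine_mul_pow ht hr
      omega)
  calc _ ≤ (2 : ℝ) ^ (r ^ t) * (2 : ℝ) ^ (-(T.card : ℝ)) := by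
        rw [Real.rpow_neg zero_le_two, Real.rpow_natCast, ← div_eq_mul_inv,
          le_div_iff₀ (by positivity)]
        exact_mod_cast hcount
    _ ≤ _ := by
        gcongr
        · exact one_le_two
        · linarith

theorem exists_forall_pow_self_le :
    ∃ n₀ : ℕ, ∀ n : ℕ, n₀ ≤ n → (n : ℝ) ^ n ≤ (2 : ℝ) ^ ((1 / 36) * (n : ℝ) ^ 2) := by
  have hb : 1 < (2 : ℝ) ^ (1 / 36 : ℝ) := Real.one_lt_rpow one_lt_two (by norm_num)
  obtain ⟨n₀, h⟩ := Filter.eventually_atTop.1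
    ((tendsto_pow_const_div_const_pow_of_one_lt 1 hb).eventually_le_const one_pos)
  refine ⟨n₀, fun n hn => ?_⟩
  have hn' := h n hn
  rw [pow_one, div_le_one (by positivity)] at hn'
  calc (n : ℝ) ^ n ≤ (((2 : ℝ) ^ (1 / 36 : ℝ)) ^ n) ^ n := by gcongr
    _ = _ := by
      rw [← Real.rpow_natCast, ← Real.rpow_natCast, ← Real.rpow_mul zero_le_two,
        ← Real.rpow_mul zero_le_two]
      ring_nf

theorem random_transversal_hypergraph_asymmetric :
    ∃ c : ℝ, 0 < c ∧ ∃ n₀ : ℕ, ∀ t r : ℕ, 3 ≤ t → 2 ≤ r →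
      n₀ ≤ t * r → 2 * t ≤ t * r →
      (Set.ncard {ℋ : Set (Fin t → Fin r) |
          ∃ (τ : Equiv.Perm (Fin t)) (π : Fin t → Equiv.Perm (Fin r)),
            (fun f : Fin t → Fin r => fun j => π (τ⁻¹ j) (f (τ⁻¹ j))) '' ℋ = ℋ ∧
            ¬ (∀ (i : Fin t) (x : Fin r), τ i = i ∧ π i x = x)} : ℝ) ≤
        2 ^ (r ^ t) * (2 : ℝ) ^ (-c * ((t * r : ℕ) : ℝ) ^ 2) := by
  classical
  obtain ⟨n₀, hn₀⟩ := exists_forall_pow_self_le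
  refine ⟨1 / 36, by norm_num, n₀, fun t r ht hr hn _ => ?_⟩
  set F : Equiv.Perm (Fin t) × (Fin t → Equiv.Perm (Fin r)) → Set (Set (Fin t → Fin r)) :=
    fun p => {ℋ | (fun f : Fin t → Fin r => fun j => p.2 (p.1⁻¹ j) (f (p.1⁻¹ j))) '' ℋ = ℋ ∧
      ¬ (∀ (i : Fin t) (x : Fin r), p.1 i = i ∧ p.2 i x = x)} with hF
  have hunion : {ℋ : Set (Fin t → Fin r) |
      ∃ (τ : Equiv.Perm (Fin t)) (π : Fin t → Equiv.Perm (Fin r)),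
        (fun f : Fin t → Fin r => fun j => π (τ⁻¹ j) (f (τ⁻¹ j))) '' ℋ = ℋ ∧
        ¬ (∀ (i : Fin t) (x : Fin r), τ i = i ∧ π i x = x)} = ⋃ p, F p := by
    ext ℋ
    simp only [hF, Set.mem_iUnion, Set.mem_ofPred_eq, Prod.exists]
  have hbound : ∀ p, ((F p).ncard : ℝ) ≤
      2 ^ (r ^ t) * (2 : ℝ) ^ (-(1 / 18) * ((t * r : ℕ) : ℝ) ^ 2) := by
    intro p
    by_cases hp : ∀ (i : Fin t) (x : Fin r), p.1 i = i ∧ p.2 i x = x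
    · have : F p = ∅ := Set.eq_empty_of_forall_notMem fun ℋ hℋ => hℋ.2 hp
      rw [this, Set.ncard_empty, Nat.cast_zero]
      positivity
    · refine le_trans ?_ (ncard_fixed_le ht hr p.1 p.2 hp)
      have hsub : F p ⊆ {ℋ | (fun f : Fin t → Fin r => fun j => p.2 (p.1⁻¹ j) (f (p.1⁻¹ j))) '' ℋ = ℋ} :=
        fun ℋ hℋ => hℋ.1
      exact_mod_cast Set.ncard_le_ncard hsub (Set.toFinite _)
  have hcard : (Fintype.card (Equiv.Perm (Fin t) × (Fin t → Equiv.Perm (Fin r))) : ℝ) ≤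
      ((t * r : ℕ) : ℝ) ^ (t * r) := by
    rw [Fintype.card_prod, Fintype.card_fun, Fintype.card_perm, Fintype.card_perm,
      Fintype.card_fin, Fintype.card_fin]
    exact_mod_cast factorial_mul_factorial_pow_le (one_le_two.trans hr)
  rw [hunion]
  calc ((⋃ p, F p).ncard : ℝ) ≤ ∑ p, ((F p).ncard : ℝ) := by
        exact_mod_cast Set.ncard_iUnion_le_of_fintype F
    _ ≤ ∑ _p : Equiv.Perm (Fin t) × (Fin t → Equiv.Perm (Fin r)),
          2 ^ (r ^ t) * (2 : ℝ) ^ (-(1 / 18) * ((t * r : ℕ) : ℝ) ^ 2) :=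
        Finset.sum_le_sum fun p _ => hbound p
    _ ≤ (2 : ℝ) ^ ((1 / 36) * ((t * r : ℕ) : ℝ) ^ 2) *
          (2 ^ (r ^ t) * (2 : ℝ) ^ (-(1 / 18) * ((t * r : ℕ) : ℝ) ^ 2)) := by
        rw [Finset.sum_const, Finset.card_univ, nsmul_eq_mul]
        gcongr
        exact hcard.trans (hn₀ _ hn)
    _ = 2 ^ (r ^ t) * (2 : ℝ) ^ (-(1 / 36) * ((t * r : ℕ) : ℝ) ^ 2) := by
        rw [mul_left_comm, ← Real.rpow_add two_pos]
        ring_nf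
end

section
/- Let m ≥ 3, let X be the set of all 2-element subsets of Fin m (so |X| = C(m,2)), and let G ≤ Sym(X) be the image of the alternating group Alt(Fin m) under the action of Sym(Fin m) on 2-element subsets. If k ≥ 1 and ℬ is a family of k-element subsets of X such that Aut(X,ℬ) = G, then 2·k ≥ m − 1. -/
/-- The permutation of the `k`-element subsets of `Fin m` induced by a permutation of `Fin m`. -/
def inducedPermOnSubsets (m k : ℕ) (σ : Equiv.Perm (Fin m)) :
    Equiv.Perm {s : Finset (Fin m) // s.card = k} :=
  Equiv.subtypeEquiv σ.finsetCongr (fun s => by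
    rw [Equiv.finsetCongr_apply, Finset.card_map])

theorem inducedPermOnSubsets_apply_coe (m k : ℕ) (σ : Equiv.Perm (Fin m))
    (s : {s : Finset (Fin m) // s.card = k}) :
    (inducedPermOnSubsets m k σ s : Finset (Fin m)) = s.1.map σ.toEmbedding := rfl

theorem inducedPermOnSubsets_mul_apply (m k : ℕ) (σ τ : Equiv.Perm (Fin m))
    (s : {s : Finset (Fin m) // s.card = k}) :
    inducedPermOnSubsets m k (σ * τ) s =
      inducedPermOnSubsets m k σ (inducedPermOnSubsets m k τ s) := by
  apply Subtype.ext
  ext x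
  simp only [inducedPermOnSubsets_apply_coe, Finset.mem_map_equiv]
  rfl

theorem inducedPermOnSubsets_one_apply (m k : ℕ) (s : {s : Finset (Fin m) // s.card = k}) :
    inducedPermOnSubsets m k 1 s = s := by
  apply Subtype.ext
  ext x
  simp only [inducedPermOnSubsets_apply_coe, Finset.mem_map_equiv]
  rfl

theorem inducedPermOnSubsets_two_injective {m : ℕ} (hm : 3 ≤ m) :
    Function.Injective (inducedPermOnSubsets m 2) := by
  intro σ τ h
  have key : ∀ x y : Fin m, x ≠ y → σ x = τ x ∨ σ x = τ y := by
    intro x y hxy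
    have h₁ := congrArg Subtype.val (DFunLike.congr_fun h ⟨{x, y}, Finset.card_pair hxy⟩)
    simp only [inducedPermOnSubsets_apply_coe] at h₁
    have h₂ : σ x ∈ Finset.map τ.toEmbedding {x, y} := by
      rw [← h₁]
      simp
    simpa [eq_comm] using h₂
  ext1 x
  obtain ⟨y, hy⟩ : ∃ y, y ∉ ({x} : Finset (Fin m)) := by
    apply Finset.exists_mem_notMem_of_card_lt_card (t := Finset.univ) _ |>.imp
    · exact fun _ h => h.2
    · simp; omega
  obtain ⟨z, hz⟩ : ∃ z, z ∉ ({x, y} : Finset (Fin m)) := by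
    apply Finset.exists_mem_notMem_of_card_lt_card (t := Finset.univ) _ |>.imp
    · exact fun _ h => h.2
    · have := Finset.card_le_two (a := x) (b := y)
      simp only [Finset.card_univ, Fintype.card_fin]
      omega
  simp only [Finset.mem_insert, Finset.mem_singleton, not_or] at hy hz
  rcases key x y (Ne.symm hy) with h₁ | h₁
  · exact h₁
  rcases key x z (Ne.symm hz.1) with h₂ | h₂
  · exact h₂
  exact absurd (τ.injective (h₂.symm.trans h₁)) hz.2

/-- If a family of pairs is small enough, some transposition fixes all of its members. -/
theorem exists_swap_inducedPermOnSubsets_eq {m : ℕ}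
    (B : Set {s : Finset (Fin m) // s.card = 2}) (hB : 2 * B.ncard + 2 ≤ m) :
    ∃ a b : Fin m, a ≠ b ∧ ∀ e ∈ B, inducedPermOnSubsets m 2 (Equiv.swap a b) e = e := by
  classical
  set V : Finset (Fin m) := B.toFinset.biUnion Subtype.val with hV
  have hVcard : V.card ≤ B.ncard * 2 := by
    rw [Set.ncard_eq_toFinset_card']
    exact Finset.card_biUnion_le_card_mul _ _ _ fun e _ => e.2.le
  have hVc : 1 < Vᶜ.card := by
    rw [Finset.card_compl, Fintype.card_fin]
    omega
  obtain ⟨a, ha, b, hb, hab⟩ := Finset.one_lt_card.mp hVc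
  refine ⟨a, b, hab, fun e he => Subtype.ext ?_⟩
  have hmem : ∀ x ∈ e.1, x ∈ V := fun x hx =>
    Finset.mem_biUnion.mpr ⟨e, Set.mem_toFinset.mpr he, hx⟩
  rw [Finset.mem_compl] at ha hb
  rw [inducedPermOnSubsets_apply_coe, Finset.map_eq_image]
  refine (Finset.image_congr (g := id) fun x hx => ?_).trans Finset.image_id
  exact Equiv.swap_apply_of_ne_of_ne (fun h => ha (h ▸ hmem x hx)) fun h => hb (h ▸ hmem x hx)

theorem edge_size_lower_bound_for_alternating_on_pairs
    (m : ℕ) (hm : 3 ≤ m) (k : ℕ) (hk : 1 ≤ k)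
    (ℬ : Set (Set {s : Finset (Fin m) // s.card = 2}))
    (hcard : ∀ B ∈ ℬ, B.ncard = k)
    (hAut : ∀ τ : Equiv.Perm {s : Finset (Fin m) // s.card = 2},
      ((fun Y : Set {s : Finset (Fin m) // s.card = 2} =>
          (τ : _ → _) '' Y) '' ℬ = ℬ) ↔
        ∃ σ ∈ alternatingGroup (Fin m), τ = inducedPermOnSubsets m 2 σ) :
    m - 1 ≤ 2 * k := by
  by_contra! hlt
  obtain ⟨t, ht, htt⟩ : ∃ t : Equiv.Perm (Fin m), Equiv.Perm.sign t = -1 ∧ t * t = 1 :=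
    ⟨Equiv.swap ⟨0, by omega⟩ ⟨1, by omega⟩, Equiv.Perm.sign_swap (by simp),
      Equiv.swap_mul_self _ _⟩
  have hmaps : ∀ B ∈ ℬ, inducedPermOnSubsets m 2 t '' B ∈ ℬ := by
    intro B hB
    obtain ⟨a, b, hab, hfix⟩ := exists_swap_inducedPermOnSubsets_eq B (by
      rw [hcard B hB]
      omega)
    have heven : t * Equiv.swap a b ∈ alternatingGroup (Fin m) := by
      simp [Equiv.Perm.mem_alternatingGroup, ht, Equiv.Perm.sign_swap hab]
    have himage := (hAut _).mpr ⟨_, heven, rfl⟩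
    have hmem := himage.subset (Set.mem_image_of_mem _ hB)
    convert hmem using 1
    refine Set.image_congr fun e he => ?_
    rw [inducedPermOnSubsets_mul_apply, hfix e he]
  obtain ⟨σ, hσ, hσt⟩ := (hAut (inducedPermOnSubsets m 2 t)).mp (by
    refine Set.Subset.antisymm (Set.image_subset_iff.mpr hmaps) fun B hB =>
      ⟨_, hmaps B hB, ?_⟩
    simp only [Set.image_image, ← inducedPermOnSubsets_mul_apply, htt,
      inducedPermOnSubsets_one_apply, Set.image_id'])
  rw [← inducedPermOnSubsets_two_injective hm hσt, Equiv.Perm.mem_alternatingGroup, ht] at hσ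
  exact absurd hσ (by decide)
end
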